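/- Let F = FreeGroup X be a free group on an infinite type X, and let R be a fully invariant subgroup of F which is contained in the commutator subgroup F' = ⁅F,F⁆ and such that the quotient group F/R is residually torsion-free nilpotent. Then the automorphism group Aut(F ⧸ ⁅R,R⁆) of the group F/R' is complete: its center is trivial and every automorphism of Aut(F ⧸ ⁅R,R⁆) is inner. -/

import Mathlib

/-- A group `H` is residually torsion-free nilpotent if every nonidentity element
survives in some torsion-free nilpotent quotient of `H`. -/
def ResiduallyTorsionFreeNilpotent (H : Type*) [Group H] : Prop :=
  ∀ h : H, h ≠ 1 → ∃ N : Subgroup H, ∃ hN : N.Normal,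
    h ∉ N ∧
    (letI := hN;
      Group.IsNilpotent (H ⧸ N) ∧ ∀ g : H ⧸ N, g ≠ 1 → ∀ n : ℕ, n ≠ 0 → g ^ n ≠ 1)

section

open scoped commutatorElement

/-- The data of a Magnus-type extension `G` of a group `N`: the group `G` is relatively free on
the letters `ι x`, the kernel of `q : G →* N` is abelian, every endomorphism of `G` induces one
of `N`, and `D` is the universal Fox derivation with values in the free `ℤ[N]`-module. -/
structure MagnusExtension (X G N : Type*) [Group G] [Group N] where
  ι : X → G
  lift : (X → G) → (G →* G)
  lift_ι : ∀ f x, lift f (ι x) = f x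
  closure_range : Subgroup.closure (Set.range ι) = ⊤
  q : G →* N
  q_surjective : Function.Surjective q
  bar : (G →* G) → (N →* N)
  bar_q : ∀ f g, bar f (q g) = q (f g)
  D : G → X →₀ MonoidAlgebra ℤ N
  D_ι : ∀ x, D (ι x) = Finsupp.single x 1
  D_mul : ∀ g h, D (g * h) = D g + MonoidAlgebra.of ℤ N (q g) • D h
  ker_comm : ∀ g h, q g = 1 → q h = 1 → g * h = h * g
  q_ι_ne_one : ∀ x, q (ι x) ≠ 1
  torsion_free : ∀ n : N, ∀ k : ℕ, k ≠ 0 → n ^ k = 1 → n = 1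

namespace MagnusExtension

open MonoidAlgebra (of)

variable {X G N : Type*} [Group G] [Group N] (S : MagnusExtension X G N)

attribute [simp] lift_ι bar_q

@[simp]
lemma single_one_one : (MonoidAlgebra.single (1 : N) (1 : ℤ)) = 1 :=
  MonoidAlgebra.one_def.symm

lemma hom_ext {f g : G →* G} (h : ∀ x, f (S.ι x) = g (S.ι x)) : f = g := by
  refine MonoidHom.eq_of_eqOn_dense S.closure_range ?_
  rintro _ ⟨x, rfl⟩
  exact h x

@[elab_as_elim]
lemma induction {p : G → Prop} (g : G) (ι : ∀ x, p (S.ι x)) (one : p 1)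
    (mul : ∀ g h, p g → p h → p (g * h)) (inv : ∀ g, p g → p g⁻¹) : p g := by
  have hg : g ∈ Subgroup.closure (Set.range S.ι) := by simp [S.closure_range]
  induction hg using Subgroup.closure_induction with
  | mem x hx => obtain ⟨y, rfl⟩ := hx; exact ι y
  | one => exact one
  | mul x y _ _ hx hy => exact mul x y hx hy
  | inv x _ hx => exact inv x hx

/-- Every element involves only finitely many letters. -/
lemma exists_finset (g : G) : ∃ A : Finset X, ∀ f₁ f₂ : G →* G,
    (∀ x ∈ A, f₁ (S.ι x) = f₂ (S.ι x)) → f₁ g = f₂ g := by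
  classical
  induction g using S.induction with
  | ι x => exact ⟨{x}, fun f₁ f₂ h => h x (by simp)⟩
  | one => exact ⟨∅, by simp⟩
  | mul g h hg hh =>
    obtain ⟨A, hA⟩ := hg
    obtain ⟨B, hB⟩ := hh
    refine ⟨A ∪ B, fun f₁ f₂ h => ?_⟩
    rw [map_mul, map_mul, hA f₁ f₂ fun x hx => h x (by simp [hx]),
      hB f₁ f₂ fun x hx => h x (by simp [hx])]
  | inv g hg =>
    obtain ⟨A, hA⟩ := hg
    exact ⟨A, fun f₁ f₂ h => by rw [map_inv, map_inv, hA f₁ f₂ h]⟩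

lemma bar_bar (f g : G →* G) (n : N) : S.bar f (S.bar g n) = S.bar (f.comp g) n := by
  obtain ⟨g, rfl⟩ := S.q_surjective n
  simp

lemma bar_id (n : N) : S.bar (MonoidHom.id G) n = n := by
  obtain ⟨g, rfl⟩ := S.q_surjective n
  simp

/-- The endomorphism of the group ring induced by an endomorphism of `G`. -/
noncomputable def ring (f : G →* G) : MonoidAlgebra ℤ N →+* MonoidAlgebra ℤ N :=
  MonoidAlgebra.mapDomainRingHom ℤ (S.bar f)

@[simp]
lemma ring_single (f : G →* G) (n : N) (k : ℤ) :
    S.ring f (MonoidAlgebra.single n k) = MonoidAlgebra.single (S.bar f n) k := by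
  simp [ring]

@[simp]
lemma ring_of (f : G →* G) (n : N) : S.ring f (of ℤ N n) = of ℤ N (S.bar f n) := by
  simp [of]

lemma ring_ring (f g : G →* G) (a : MonoidAlgebra ℤ N) :
    S.ring f (S.ring g a) = S.ring (f.comp g) a := by
  induction a using MonoidAlgebra.induction_linear with
  | zero => simp
  | add a b ha hb => simp [ha, hb]
  | single n k => simp [bar_bar]

lemma ring_id (a : MonoidAlgebra ℤ N) : S.ring (MonoidHom.id G) a = a := by
  induction a using MonoidAlgebra.induction_linear with
  | zero => simp
  | add a b ha hb => simp [ha, hb]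
  | single n k => simp [bar_id]

@[simp]
lemma D_one : S.D 1 = 0 := by
  have := S.D_mul 1 1
  simpa using this

lemma D_inv (g : G) : S.D g⁻¹ = -(of ℤ N (S.q g)⁻¹ • S.D g) := by
  have h := S.D_mul g⁻¹ g
  rw [inv_mul_cancel, D_one, map_inv] at h
  exact eq_neg_of_add_eq_zero_left h.symm

/-- The chain rule for Fox derivatives. -/
lemma D_map (f : G →* G) (g : G) :
    S.D (f g) = (S.D g).sum fun x a => S.ring f a • S.D (f (S.ι x)) := by
  have hadd : ∀ u v : X →₀ MonoidAlgebra ℤ N,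
      ((u + v).sum fun x a => S.ring f a • S.D (f (S.ι x))) =
        (u.sum fun x a => S.ring f a • S.D (f (S.ι x))) +
        (v.sum fun x a => S.ring f a • S.D (f (S.ι x))) := fun u v =>
    Finsupp.sum_add_index' (by simp) (by simp [add_smul])
  have hsmul : ∀ (a : MonoidAlgebra ℤ N) (v : X →₀ MonoidAlgebra ℤ N),
      ((a • v).sum fun x b => S.ring f b • S.D (f (S.ι x))) =
        S.ring f a • (v.sum fun x b => S.ring f b • S.D (f (S.ι x))) := fun a v => by
    rw [Finsupp.sum_smul_index (by simp), Finsupp.smul_sum]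
    simp [mul_smul]
  induction g using S.induction with
  | ι x => simp [S.D_ι]
  | one => simp
  | mul g h hg hh =>
    rw [map_mul, D_mul, D_mul, hadd, hsmul, hg, hh, ring_of, bar_q]
  | inv g hg =>
    rw [map_inv, D_inv, D_inv, ← neg_smul, ← neg_smul, hsmul, hg, map_neg, ring_of,
      map_inv (S.bar f), bar_q]

/-- The boundary map of the Gruenberg resolution. -/
noncomputable def boundary : (X →₀ MonoidAlgebra ℤ N) →ₗ[MonoidAlgebra ℤ N] MonoidAlgebra ℤ N :=
  Finsupp.linearCombination _ fun x => of ℤ N (S.q (S.ι x)) - 1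

lemma boundary_D (g : G) : S.boundary (S.D g) = of ℤ N (S.q g) - 1 := by
  induction g using S.induction with
  | ι x => simp [boundary, S.D_ι]
  | one => simp
  | mul g h hg hh =>
    rw [D_mul, map_add, map_smul, hg, hh, map_mul, smul_eq_mul, map_mul]
    noncomm_ring
  | inv g hg =>
    rw [D_inv, map_neg, map_smul, hg, map_inv S.q, smul_eq_mul, mul_sub, ← map_mul]
    simp

instance kerCommGroup : CommGroup S.q.ker :=
  { (inferInstance : Group S.q.ker) with
    mul_comm := fun a b => Subtype.ext (S.ker_comm _ _ a.2 b.2) }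

/-- A set-theoretic section of `q`. -/
noncomputable def sec (n : N) : G := Function.surjInv S.q_surjective n

@[simp]
lemma q_sec (n : N) : S.q (S.sec n) = n := Function.surjInv_eq _ n

/-- The kernel element measuring the failure of the section to be multiplicative. -/
noncomputable def cocycle (n : N) (g : G) : S.q.ker :=
  ⟨S.sec n * g * (S.sec (n * S.q g))⁻¹, by simp [MonoidHom.mem_ker]⟩

/-- The retraction from the free module to the kernel determined by the section. -/
noncomputable def retraction : (X →₀ MonoidAlgebra ℤ N) →+ Additive S.q.ker :=
  Finsupp.liftAddHom fun x =>
    (Finsupp.liftAddHom fun n =>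
      zmultiplesHom _ (Additive.ofMul (S.cocycle n (S.ι x)))).comp
        (MonoidAlgebra.coeffAddEquiv (R := ℤ) (M := N)).toAddMonoidHom

lemma retraction_single (x : X) (n : N) (k : ℤ) :
    S.retraction (Finsupp.single x (MonoidAlgebra.single n k)) =
      k • Additive.ofMul (S.cocycle n (S.ι x)) := by
  simp [retraction]

lemma retraction_smul_D (g : G) (n : N) :
    S.retraction (of ℤ N n • S.D g) = Additive.ofMul (S.cocycle n g) := by
  induction g using S.induction generalizing n with
  | ι x =>
    rw [S.D_ι, Finsupp.smul_single, smul_eq_mul, mul_one, MonoidAlgebra.of_apply,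
      retraction_single, one_smul]
  | one =>
    rw [D_one, smul_zero, map_zero, eq_comm, ofMul_eq_zero]
    exact Subtype.ext (by simp [cocycle])
  | mul g h hg hh =>
    rw [D_mul, smul_add, ← mul_smul, ← map_mul, map_add, hg, hh, ← ofMul_mul]
    exact congrArg Additive.ofMul (Subtype.ext (by simp [cocycle, mul_assoc]))
  | inv g hg =>
    rw [D_inv, smul_neg, ← mul_smul, ← map_mul, map_neg, hg, ← ofMul_inv]
    exact congrArg Additive.ofMul (Subtype.ext (by simp [cocycle, mul_assoc]))

/-- The Magnus embedding is injective. -/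
lemma eq_of_D_eq {g h : G} (hq : S.q g = S.q h) (hD : S.D g = S.D h) : g = h := by
  have h0 : S.D (g * h⁻¹) = 0 := by
    rw [D_mul, D_inv, smul_neg, ← mul_smul, ← map_mul, hq, hD]
    simp
  have h1 := S.retraction_smul_D (g * h⁻¹) 1
  rw [h0, smul_zero, map_zero, eq_comm, ofMul_eq_zero] at h1
  have h2 := congrArg Subtype.val h1
  simp only [cocycle, map_mul, map_inv, hq, mul_inv_cancel, mul_one, OneMemClass.coe_one] at h2
  rw [mul_inv_eq_one, mul_eq_left] at h2
  exact mul_inv_eq_one.mp h2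

lemma D_coe_ker_add (a b : Additive S.q.ker) :
    S.D ((a + b).toMul : S.q.ker) = S.D (a.toMul : S.q.ker) + S.D (b.toMul : S.q.ker) := by
  rw [toMul_add, Subgroup.coe_mul, D_mul, a.toMul.2]
  simp

/-- Exactness of the Gruenberg resolution at the free module. -/
lemma exists_D_eq (v : X →₀ MonoidAlgebra ℤ N) (hv : S.boundary v = 0) :
    ∃ r, S.q r = 1 ∧ S.D r = v := by
  let E : Additive S.q.ker →+ (X →₀ MonoidAlgebra ℤ N) :=
    AddMonoidHom.mk' (fun a => S.D (a.toMul : S.q.ker)) S.D_coe_ker_add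
  let P : MonoidAlgebra ℤ N →+ (X →₀ MonoidAlgebra ℤ N) :=
    (Finsupp.liftAddHom fun n => zmultiplesHom _ (S.D (S.sec n))).comp
      (MonoidAlgebra.coeffAddEquiv (R := ℤ) (M := N)).toAddMonoidHom
  have hP : ∀ n k, P (MonoidAlgebra.single n k) = k • S.D (S.sec n) := fun n k => by simp [P]
  have key : E.comp S.retraction + P.comp S.boundary.toAddMonoidHom = AddMonoidHom.id _ := by
    refine Finsupp.addHom_ext' fun x => MonoidAlgebra.addMonoidHom_ext fun n k => ?_
    have hb : S.boundary (Finsupp.single x (MonoidAlgebra.single n k)) =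
        MonoidAlgebra.single (n * S.q (S.ι x)) k - MonoidAlgebra.single n k := by
      simp [boundary, mul_sub, MonoidAlgebra.single_mul_single]
    have hE : E (Additive.ofMul (S.cocycle n (S.ι x))) = S.D (S.sec n) +
        of ℤ N n • Finsupp.single x 1 - S.D (S.sec (n * S.q (S.ι x))) := by
      change S.D (S.sec n * S.ι x * (S.sec (n * S.q (S.ι x)))⁻¹) = _
      rw [D_mul, D_mul, D_inv, smul_neg, ← mul_smul, ← map_mul, S.D_ι]
      simp [sub_eq_add_neg]
    simp only [AddMonoidHom.comp_apply, AddMonoidHom.add_apply, Finsupp.singleAddHom_apply,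
      AddMonoidHom.id_apply, LinearMap.toAddMonoidHom_coe]
    rw [hb, retraction_single, map_zsmul, hE, map_sub, hP, hP, smul_sub, smul_add]
    have : k • (of ℤ N n • Finsupp.single x (1 : MonoidAlgebra ℤ N)) =
        Finsupp.single x (MonoidAlgebra.single n k) := by
      rw [Finsupp.smul_single, Finsupp.smul_single, smul_eq_mul, mul_one, MonoidAlgebra.of_apply,
        MonoidAlgebra.smul_single]
      simp
    rw [this]
    abel
  refine ⟨(S.retraction v).toMul, (S.retraction v).toMul.2, ?_⟩
  have := DFunLike.congr_fun key v
  simp only [AddMonoidHom.add_apply, AddMonoidHom.comp_apply, LinearMap.toAddMonoidHom_coe, hv,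
    map_zero, add_zero, AddMonoidHom.id_apply] at this
  exact this

end MagnusExtension

/-- Torsion-free abelian groups embed in rational vector spaces, so they have two unique
products. -/
lemma TwoUniqueProds.of_isMulTorsionFree (C : Type*) [CommGroup C] [IsMulTorsionFree C] :
    TwoUniqueProds C := by
  have htwo : TwoUniqueSums (Additive C) :=
    TwoUniqueSums.of_injective_addHom
      (⟨fun c => (c : DivisibleHull (Additive C)), fun c d => DivisibleHull.coe_add⟩ :
        AddHom (Additive C) (DivisibleHull (Additive C)))
      (fun c d h => DivisibleHull.coe_injective h) inferInstance
  exact ⟨fun {A B} h => htwo.uniqueAdd_of_one_lt_card (A := A) (B := B) h⟩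

/-- The only invertible elements of the integral group ring supported on a torsion-free central
subset are monomials. -/
lemma MonoidAlgebra.exists_eq_single_of_mul_eq_one {N : Type*} [Group N]
    (torsion_free : ∀ n : N, ∀ k : ℕ, k ≠ 0 → n ^ k = 1 → n = 1) {a b : MonoidAlgebra ℤ N}
    (ha : ∀ n ∈ a.coeff.support, n ∈ Subgroup.center N) (hab : a * b = 1) :
    ∃ n e, a = MonoidAlgebra.single n e := by
  classical
  let C := Subgroup.center N
  let _ : CommGroup (Subgroup.center N) :=
    { (inferInstance : Group (Subgroup.center N)) with
      mul_comm := fun u v => Subtype.ext (Subgroup.mem_center_iff.mp v.2 u) }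
  have htf : IsMulTorsionFree (Subgroup.center N) := by
    refine ⟨fun k hk u v huv => ?_⟩
    have h1 : ((u / v : Subgroup.center N) : N) = 1 := by
      refine torsion_free _ k hk ?_
      rw [← Subgroup.coe_pow, div_pow, show u ^ k = v ^ k from huv, div_self', Subgroup.coe_one]
    exact div_eq_one.mp (Subtype.ext h1 : u / v = 1)
  have htwo : TwoUniqueProds C := TwoUniqueProds.of_isMulTorsionFree (Subgroup.center N)
  let A : Finset C := a.coeff.support.subtype (· ∈ C)
  let B : Finset C := b.coeff.support.subtype (· ∈ C)
  have lift_unique : ∀ u ∈ A, ∀ v ∈ B, UniqueMul A B u v → (u * v : N) = 1 := by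
    intro u hu v hv h
    have h' : UniqueMul a.coeff.support b.coeff.support (u : N) (v : N) := by
      intro s t hs ht hst
      have hsC := ha s hs
      have htC : t ∈ C := by
        have : t = s⁻¹ * (u * v) := by rw [← hst]; group
        rw [this]
        exact C.mul_mem (C.inv_mem hsC) (C.mul_mem u.2 v.2)
      have := @h ⟨s, hsC⟩ ⟨t, htC⟩ (by simpa [A] using hs) (by simpa [B] using ht)
        (Subtype.ext hst)
      simpa [Subtype.ext_iff] using this
    have hc := MonoidAlgebra.coeff_mul_mul_of_uniqueMul h'
    by_contra hne
    rw [hab, MonoidAlgebra.one_def, MonoidAlgebra.coeff_single,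
      Finsupp.single_eq_of_ne hne, eq_comm, mul_eq_zero] at hc
    simp only [A, B, Finset.mem_subtype, Finsupp.mem_support_iff] at hu hv
    tauto
  have hne : ∃ u ∈ a.coeff.support, ∃ v ∈ b.coeff.support, u * v = 1 := by
    have : (1 : N) ∈ (a * b).coeff.support := by
      rw [hab]; simp
    have := MonoidAlgebra.support_coeff_mul_subset a b this
    simpa [Finset.mem_mul] using this
  obtain ⟨u, hu, v, hv, huv⟩ := hne
  have hvC : v ∈ C := by
    rw [← inv_eq_of_mul_eq_one_right huv]
    exact C.inv_mem (ha u hu)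
  have hAcard : A.card ≤ 1 := by
    by_contra! hA
    have hB : 0 < B.card := Finset.card_pos.mpr ⟨⟨v, hvC⟩, by simpa [B] using hv⟩
    obtain ⟨p, hp, p', hp', hpp, h1, h2⟩ :=
      htwo.uniqueMul_of_one_lt_card (A := A) (B := B) (by nlinarith)
    rw [Finset.mem_product] at hp hp'
    have e1 := lift_unique _ hp.1 _ hp.2 h1
    have e2 := lift_unique _ hp'.1 _ hp'.2 h2
    refine hpp ?_
    have := h2 hp.1 hp.2 (Subtype.ext (by simp [e1, e2]))
    exact Prod.ext this.1 this.2
  refine ⟨u, a.coeff u, ?_⟩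
  ext n
  by_cases hn : n = u
  · simp [hn]
  · rw [MonoidAlgebra.coeff_single, Finsupp.single_eq_of_ne hn]
    by_contra h0
    have hnA : n ∈ a.coeff.support := by simpa using h0
    have := Finset.card_le_one.mp hAcard ⟨n, ha n hnA⟩ (by simpa [A] using h0) ⟨u, ha u hu⟩
      (by simpa [A] using hu)
    exact hn (congrArg Subtype.val this)

namespace MagnusExtension

open MonoidAlgebra (of)

variable {X G N : Type*} [Group G] [Group N] (S : MagnusExtension X G N)

section GroupRing

lemma bar_congr {f g k : G →* G} (h : f.comp k = g.comp k) {n : N} (hn : S.bar k n = n) :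
    S.bar f n = S.bar g n := by
  rw [← hn, bar_bar, bar_bar, h]

lemma ring_congr {f g k : G →* G} (h : f.comp k = g.comp k) {a : MonoidAlgebra ℤ N}
    (ha : S.ring k a = a) : S.ring f a = S.ring g a := by
  rw [← ha, ring_ring, ring_ring, h]

lemma bar_eq_of_ring_eq {k : G →* G} (hk : k.comp k = k) {a : MonoidAlgebra ℤ N}
    (ha : S.ring k a = a) {n : N} (hn : n ∈ a.coeff.support) : S.bar k n = n := by
  classical
  rw [← ha] at hn
  obtain ⟨m, -, rfl⟩ := Finset.mem_image.mp (Finsupp.mapDomain_support hn)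
  rw [bar_bar, hk]

lemma ring_eq_self {k : G →* G} {a : MonoidAlgebra ℤ N}
    (ha : ∀ n ∈ a.coeff.support, S.bar k n = n) : S.ring k a = a := by
  refine MonoidAlgebra.coeff_injective ?_
  change Finsupp.mapDomain _ _ = _
  rw [Finsupp.mapDomain_congr (g := id) ha, Finsupp.mapDomain_id]

end GroupRing

open Classical in
/-- The endomorphism sending the letters from `A` to `1` and fixing all other letters. -/
noncomputable def kill (A : Set X) : G →* G := S.lift fun x => if x ∈ A then 1 else S.ι x

lemma kill_ι_of_mem {A : Set X} {x : X} (hx : x ∈ A) : S.kill A (S.ι x) = 1 := by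
  simp [kill, hx]

lemma kill_ι_of_notMem {A : Set X} {x : X} (hx : x ∉ A) : S.kill A (S.ι x) = S.ι x := by
  simp [kill, hx]

lemma kill_comp_kill (A B : Set X) : (S.kill A).comp (S.kill B) = S.kill (A ∪ B) := by
  refine S.hom_ext fun x => ?_
  by_cases hA : x ∈ A <;> by_cases hB : x ∈ B <;> simp [kill, hA, hB]

lemma kill_kill (A B : Set X) (g : G) : S.kill A (S.kill B g) = S.kill (A ∪ B) g := by
  rw [← kill_comp_kill]; rfl

lemma kill_eq_of_subset {A B : Set X} (h : A ⊆ B) {g : G} (hg : S.kill B g = g) :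
    S.kill A g = g := by
  rw [← hg, kill_kill, Set.union_eq_self_of_subset_left h]

lemma ring_kill_eq_of_subset {A B : Set X} (h : A ⊆ B) {a : MonoidAlgebra ℤ N}
    (ha : S.ring (S.kill B) a = a) : S.ring (S.kill A) a = a := by
  rw [← ha, ring_ring, kill_comp_kill, Set.union_eq_self_of_subset_left h]

open Classical in
/-- The endomorphism multiplying the letter `x` by the letter `y` on the right. -/
noncomputable def transvection (x y : X) : G →* G :=
  S.lift (Function.update S.ι x (S.ι x * S.ι y))

@[simp]
lemma transvection_ι_self (x y : X) : S.transvection x y (S.ι x) = S.ι x * S.ι y := by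
  simp [transvection]

lemma transvection_ι_of_ne {x z : X} (y : X) (h : z ≠ x) :
    S.transvection x y (S.ι z) = S.ι z := by
  simp [transvection, h]

lemma transvection_comp_kill {x : X} (y : X) {A : Set X} (hx : x ∈ A) :
    (S.transvection x y).comp (S.kill A) = S.kill A := by
  refine S.hom_ext fun z => ?_
  by_cases hz : z ∈ A
  · simp [kill_ι_of_mem, hz]
  · have : z ≠ x := fun h => hz (h ▸ hx)
    simp [kill_ι_of_notMem, hz, transvection_ι_of_ne, this]

lemma D_map_apply (f : G →* G) (g : G) (c : X) :
    S.D (f g) c = (S.D g).sum fun x a => S.ring f a * S.D (f (S.ι x)) c := by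
  rw [D_map, Finsupp.sum_apply]
  rfl

lemma D_map_apply_eq (f : G →* G) (g : G) (c : X)
    (h : ∀ x, x ≠ c → S.D (f (S.ι x)) c = 0) :
    S.D (f g) c = S.ring f (S.D g c) * S.D (f (S.ι c)) c := by
  rw [D_map_apply, Finsupp.sum, Finset.sum_eq_single c]
  · intro x _ hx; rw [h x hx, mul_zero]
  · intro hc; rw [Finsupp.notMem_support_iff.mp hc, map_zero, zero_mul]

lemma D_kill_of_mem {A : Set X} {c : X} (hc : c ∈ A) (g : G) : S.D (S.kill A g) c = 0 := by
  rw [D_map_apply_eq, kill_ι_of_mem _ hc, D_one, Finsupp.zero_apply, mul_zero]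
  intro x hx
  by_cases hA : x ∈ A
  · simp [kill_ι_of_mem, hA]
  · simp [kill_ι_of_notMem, hA, S.D_ι, hx.symm]

lemma D_kill_of_notMem {A : Set X} {c : X} (hc : c ∉ A) (g : G) :
    S.D (S.kill A g) c = S.ring (S.kill A) (S.D g c) := by
  rw [D_map_apply_eq, kill_ι_of_notMem _ hc, S.D_ι, Finsupp.single_eq_same, mul_one]
  intro x hx
  by_cases hA : x ∈ A
  · simp [kill_ι_of_mem, hA]
  · simp [kill_ι_of_notMem, hA, S.D_ι, hx.symm]

lemma D_transvection_of_ne {x y c : X} (hc : c ≠ y) (g : G) :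
    S.D (S.transvection x y g) c = S.ring (S.transvection x y) (S.D g c) := by
  have h : ∀ z, S.D (S.transvection x y (S.ι z)) c = S.D (S.ι z) c := by
    intro z
    by_cases hz : z = x
    · subst hz
      simp [D_mul, S.D_ι, hc.symm]
    · rw [transvection_ι_of_ne _ _ hz]
  rw [D_map_apply_eq, h, S.D_ι, Finsupp.single_eq_same, mul_one]
  intro z hz
  rw [h, S.D_ι, Finsupp.single_eq_of_ne hz.symm]

lemma D_transvection_right {x y : X} (hxy : x ≠ y) (g : G) :
    S.D (S.transvection x y g) y = S.ring (S.transvection x y) (S.D g y) +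
      S.ring (S.transvection x y) (S.D g x) * of ℤ N (S.q (S.ι x)) := by
  classical
  rw [D_map_apply, Finsupp.sum_of_support_subset (s := (S.D g).support ∪ {x, y}) _
    Finset.subset_union_left _
    (by simp), ← Finset.sum_subset (s₁ := {y, x}) (by intro; simp; tauto),
    Finset.sum_pair hxy.symm]
  · rw [transvection_ι_of_ne _ _ hxy.symm, transvection_ι_self, D_mul, S.D_ι, S.D_ι]
    simp [hxy]
  · intro z _ hz
    simp only [Finset.mem_insert, Finset.mem_singleton, not_or] at hz
    rw [transvection_ι_of_ne _ _ hz.2, S.D_ι, Finsupp.single_eq_of_ne (Ne.symm hz.1), mul_zero]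

end MagnusExtension

namespace MagnusExtension

open MonoidAlgebra (of)

variable {X G N : Type*} [Group G] [Group N] (S : MagnusExtension X G N)

lemma kill_eq_of_forall_mem {A B : Set X} {g : G} (hA : S.kill A g = g) (hB : S.kill B g = g) :
    S.kill (A ∪ B) g = g := by
  rw [← kill_kill, hB, hA]

lemma ring_kill_union {A B : Set X} {a : MonoidAlgebra ℤ N} (hA : S.ring (S.kill A) a = a)
    (hB : S.ring (S.kill B) a = a) : S.ring (S.kill (A ∪ B)) a = a := by
  rw [← kill_comp_kill, ← ring_ring, hB, hA]

open Classical in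
/-- The endomorphism sending `x` to `1` and `y` to `x`. -/
noncomputable def shiftLetter (x y : X) : G →* G :=
  S.lift (Function.update (Function.update S.ι y (S.ι x)) x 1)

lemma shiftLetter_comp_transvection {x y : X} (hxy : x ≠ y) :
    ((S.shiftLetter x y).comp (S.transvection x y)).comp (S.kill {y}) =
      (MonoidHom.id G).comp (S.kill {y}) := by
  refine S.hom_ext fun z => ?_
  by_cases hz : z = y
  · subst hz; simp [kill_ι_of_mem]
  have h1 : S.kill {y} (S.ι z) = S.ι z := S.kill_ι_of_notMem (by simpa using hz)
  by_cases hx : z = x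
  · subst hx; simp [h1, shiftLetter, hxy.symm]
  · simp [h1, transvection_ι_of_ne, hx, shiftLetter, hz]

lemma shiftLetter_comp_kill {x y : X} (hxy : x ≠ y) :
    (S.shiftLetter x y).comp (S.kill {y}) = (S.kill {x}).comp (S.kill {y}) := by
  refine S.hom_ext fun z => ?_
  by_cases hz : z = y
  · subst hz; simp [kill_ι_of_mem]
  have h1 : S.kill {y} (S.ι z) = S.ι z := S.kill_ι_of_notMem (by simpa using hz)
  by_cases hx : z = x
  · subst hx; simp [h1, shiftLetter, kill_ι_of_mem]
  · simp [h1, kill_ι_of_notMem, hx, shiftLetter, hz]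

lemma ring_kill_of_transvection {x y : X} (hxy : x ≠ y) {a : MonoidAlgebra ℤ N}
    (hy : S.ring (S.kill {y}) a = a) (h : S.ring (S.transvection x y) a = a) :
    S.ring (S.kill {x}) a = a := by
  rw [← S.ring_congr (S.shiftLetter_comp_kill hxy) hy]
  nth_rw 1 [← h]
  rw [ring_ring, S.ring_congr (S.shiftLetter_comp_transvection hxy) hy, ring_id]

lemma bar_kill_of_transvection {x y : X} (hxy : x ≠ y) {n : N}
    (hy : S.bar (S.kill {y}) n = n) (h : S.bar (S.transvection x y) n = n) :
    S.bar (S.kill {x}) n = n := by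
  rw [← S.bar_congr (S.shiftLetter_comp_kill hxy) hy]
  nth_rw 1 [← h]
  rw [bar_bar, S.bar_congr (S.shiftLetter_comp_transvection hxy) hy, bar_id]

lemma kill_comp_self (A : Set X) : (S.kill A).comp (S.kill A) = S.kill A := by
  rw [kill_comp_kill, Set.union_self]

lemma bar_kill_of_mem_support {A : Set X} {a : MonoidAlgebra ℤ N}
    (ha : S.ring (S.kill A) a = a) {n : N} (hn : n ∈ a.coeff.support) :
    S.bar (S.kill A) n = n :=
  S.bar_eq_of_ring_eq (S.kill_comp_self A) ha hn

lemma eq_zero_of_of_mul_eq {x : X} {a : MonoidAlgebra ℤ N} (ha : S.ring (S.kill {x}) a = a)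
    (h : of ℤ N (S.q (S.ι x)) * a = a) : a = 0 := by
  by_contra h0
  obtain ⟨n, hn⟩ := Finsupp.support_nonempty_iff.mpr
    (fun h => h0 (MonoidAlgebra.coeff_injective h))
  have hn' : S.q (S.ι x) * n ∈ a.coeff.support := by
    rw [← h, Finsupp.mem_support_iff, MonoidAlgebra.of_apply,
      MonoidAlgebra.coeff_single_mul_apply]
    simpa using hn
  have h1 := S.bar_kill_of_mem_support ha hn
  have h2 := S.bar_kill_of_mem_support ha hn'
  rw [map_mul, h1, bar_q, kill_ι_of_mem _ (Set.mem_singleton x), map_one, one_mul] at h2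
  exact S.q_ι_ne_one x (mul_eq_right.mp h2.symm)

lemma exists_kill_singleton_eq [Infinite X] (g : G) : ∃ t, S.kill {t} g = g := by
  obtain ⟨A, hA⟩ := S.exists_finset g
  obtain ⟨t, ht⟩ := Infinite.exists_notMem_finset A
  refine ⟨t, ?_⟩
  rw [hA (S.kill {t}) (MonoidHom.id G), MonoidHom.id_apply]
  intro x hx
  refine S.kill_ι_of_notMem ?_
  rintro rfl
  exact ht hx

lemma D_apply_eq_zero {A : Set X} {g : G} (hg : S.kill A g = g) {x : X} (hx : x ∈ A) :
    S.D g x = 0 := by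
  rw [← hg, D_kill_of_mem _ hx]

lemma ring_kill_D_apply {A : Set X} {g : G} (hg : S.kill A g = g) {x : X} (hx : x ∉ A) :
    S.ring (S.kill A) (S.D g x) = S.D g x := by
  rw [← D_kill_of_notMem _ hx, hg]

lemma eq_one_of_forall_commute (S : MagnusExtension X G N) [Infinite X] {g : G}
    (hg : ∀ h, g * h = h * g) : g = 1 := by
  obtain ⟨t, ht⟩ := S.exists_kill_singleton_eq g
  have h := congrArg S.D (hg (S.ι t))
  rw [D_mul, D_mul, S.D_ι] at h
  have hDt : S.D g t = 0 := S.D_apply_eq_zero ht rfl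
  have hq : S.q g = 1 := by
    have := DFunLike.congr_fun h t
    rw [Finsupp.add_apply, Finsupp.add_apply, Finsupp.smul_apply, Finsupp.smul_apply, hDt,
      Finsupp.single_eq_same, smul_zero, zero_add, add_zero, smul_eq_mul, mul_one] at this
    exact MonoidAlgebra.of_injective (R := ℤ) (this.trans (map_one _).symm)
  refine S.eq_of_D_eq (by simp [hq]) ?_
  rw [D_one]
  ext1 c
  by_cases hc : c = t
  · rw [hc, hDt, Finsupp.zero_apply]
  · refine S.eq_zero_of_of_mul_eq (S.ring_kill_D_apply ht (by simpa using hc)) ?_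
    have := DFunLike.congr_fun h c
    simpa [Finsupp.single_eq_of_ne hc] using this.symm

/-- The family `W` behaves like the family of letters from `B`: every `W x` avoids the letters
`y ≠ x` from `B`, and replacing `x` by `x * y` changes `W x` to `W x * W y`. -/
structure LetterLike (B : Set X) (W : X → G) : Prop where
  kill_eq : ∀ x ∈ B, S.kill (B \ {x}) (W x) = W x
  transvection_eq : ∀ x ∈ B, ∀ y ∈ B, x ≠ y → S.transvection x y (W x) = W x * W y

namespace LetterLike

variable {S} {B : Set X} {W : X → G}

lemma kill_singleton_eq (hW : S.LetterLike B W) {x y : X} (hx : x ∈ B) (hy : y ∈ B) (hxy : x ≠ y) :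
    S.kill {y} (W x) = W x :=
  S.kill_eq_of_subset (by simpa using ⟨hy, hxy.symm⟩) (hW.kill_eq x hx)

lemma kill_self (hW : S.LetterLike B W) {x y : X} (hx : x ∈ B) (hy : y ∈ B) (hxy : x ≠ y) :
    S.kill {x} (W x) = 1 := by
  have h := congrArg (S.kill {y, x}) (hW.transvection_eq y hy x hx hxy.symm)
  have h1 : (S.kill {y, x}).comp (S.transvection y x) = S.kill {y, x} := by
    refine S.hom_ext fun z => ?_
    by_cases hz : z = y
    · subst hz; simp [kill_ι_of_mem]
    · simp [transvection_ι_of_ne, hz]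
  rw [← MonoidHom.comp_apply, h1, map_mul, left_eq_mul] at h
  rw [← hW.kill_singleton_eq hx hy hxy, kill_kill, Set.union_comm]
  exact h

lemma D_apply_eq_zero (hW : S.LetterLike B W) {x c : X} (hx : x ∈ B) (hc : c ∈ B) (hxc : c ≠ x) :
    S.D (W x) c = 0 :=
  S.D_apply_eq_zero (hW.kill_eq x hx) ⟨hc, hxc⟩

lemma ring_kill_D_apply (hW : S.LetterLike B W) {x c : X} (hx : x ∈ B) (hc : c ∉ B \ {x}) :
    S.ring (S.kill (B \ {x})) (S.D (W x) c) = S.D (W x) c :=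
  S.ring_kill_D_apply (hW.kill_eq x hx) hc

lemma ring_transvection_D (hW : S.LetterLike B W) {x y c : X} (hx : x ∈ B) (hy : y ∈ B)
    (hxy : x ≠ y) (hc : c ≠ y) :
    S.ring (S.transvection x y) (S.D (W x) c) =
      S.D (W x) c + of ℤ N (S.q (W x)) * S.D (W y) c := by
  rw [← D_transvection_of_ne _ hc, hW.transvection_eq x hx y hy hxy, D_mul]
  rfl

lemma ring_transvection_D_self (hW : S.LetterLike B W) {x y : X} (hx : x ∈ B) (hy : y ∈ B)
    (hxy : x ≠ y) :
    S.ring (S.transvection x y) (S.D (W x) x) = S.D (W x) x := by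
  rw [hW.ring_transvection_D hx hy hxy hxy, hW.D_apply_eq_zero hy hx hxy, mul_zero, add_zero]

lemma D_self_mul (hW : S.LetterLike B W) {x y : X} (hx : x ∈ B) (hy : y ∈ B) (hxy : x ≠ y) :
    S.D (W x) x * of ℤ N (S.q (S.ι x)) = of ℤ N (S.q (W x)) * S.D (W y) y := by
  have h := S.D_transvection_right hxy (W x)
  rw [hW.transvection_eq x hx y hy hxy, D_mul, hW.ring_transvection_D_self hx hy hxy,
    hW.D_apply_eq_zero hx hy hxy.symm, map_zero, zero_add, Finsupp.add_apply,
    hW.D_apply_eq_zero hx hy hxy.symm, zero_add] at h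
  exact h.symm

lemma exists_derivative (hW : S.LetterLike B W) (hB : B.Infinite) : ∃ a : MonoidAlgebra ℤ N,
    S.ring (S.kill B) a = a ∧ (∀ x ∈ B, S.D (W x) x = a) ∧
    ∀ x ∈ B, of ℤ N (S.q (W x)) * a = a * of ℤ N (S.q (S.ι x)) := by
  classical
  obtain ⟨x₀, hx₀⟩ := hB.nonempty
  have hconst : ∀ x ∈ B, ∀ y ∈ B, S.D (W x) x = S.D (W y) y := by
    intro x hx y hy
    obtain ⟨z, hz, hzA⟩ := hB.exists_notMem_finset {x, y}
    simp only [Finset.mem_insert, Finset.mem_singleton, not_or] at hzA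
    have h := (hW.D_self_mul hz hx hzA.1).symm.trans (hW.D_self_mul hz hy hzA.2)
    have h1 : ∀ n : N, of ℤ N n⁻¹ * of ℤ N n = 1 := fun n => by rw [← map_mul]; simp
    simpa [← mul_assoc, h1, MonoidAlgebra.single_mul_single] using
      congrArg (of ℤ N (S.q (W z))⁻¹ * ·) h
  refine ⟨S.D (W x₀) x₀, ?_, fun x hx => hconst x hx x₀ hx₀, fun x hx => ?_⟩
  · obtain ⟨y, hy, hyA⟩ := hB.exists_notMem_finset {x₀}
    have hyx : x₀ ≠ y := fun h => hyA (by simp [h])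
    have h1 := hW.ring_kill_D_apply hx₀ (c := x₀) (by simp)
    have h2 := S.ring_kill_of_transvection hyx
      (S.ring_kill_eq_of_subset (by simpa using ⟨hy, hyx.symm⟩) h1)
      (hW.ring_transvection_D_self hx₀ hy hyx)
    simpa [hx₀] using S.ring_kill_union h1 h2
  · obtain ⟨y, hy, hyA⟩ := hB.exists_notMem_finset {x}
    have hyx : x ≠ y := fun h => hyA (by simp [h])
    have := hW.D_self_mul hx hy hyx
    rw [hconst x hx x₀ hx₀, hconst y hy x₀ hx₀] at this
    exact this.symm

end LetterLike

end MagnusExtension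

namespace MagnusExtension

open MonoidAlgebra (of)

variable {X G N : Type*} [Group G] [Group N] (S : MagnusExtension X G N)

section Proj

open Classical in
/-- The part of an element of the group ring supported on the elements fixed by `kill {x}`. -/
noncomputable def proj (x : X) : MonoidAlgebra ℤ N →+ MonoidAlgebra ℤ N :=
  (MonoidAlgebra.coeffAddEquiv (R := ℤ) (M := N)).symm.toAddMonoidHom.comp
    ((Finsupp.filterAddHom fun n => S.bar (S.kill {x}) n = n).comp
      (MonoidAlgebra.coeffAddEquiv (R := ℤ) (M := N)).toAddMonoidHom)

open Classical in
lemma coeff_proj (x : X) (a : MonoidAlgebra ℤ N) :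
    (S.proj x a).coeff = a.coeff.filter fun n => S.bar (S.kill {x}) n = n := rfl

lemma proj_single_of_eq {x : X} {n : N} (h : S.bar (S.kill {x}) n = n) (k : ℤ) :
    S.proj x (MonoidAlgebra.single n k) = MonoidAlgebra.single n k := by
  classical
  refine MonoidAlgebra.coeff_injective ?_
  rw [coeff_proj, MonoidAlgebra.coeff_single,
    Finsupp.filter_single_of_pos (fun n => S.bar (S.kill {x}) n = n) h]

lemma proj_single_of_ne {x : X} {n : N} (h : S.bar (S.kill {x}) n ≠ n) (k : ℤ) :
    S.proj x (MonoidAlgebra.single n k) = 0 := by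
  classical
  refine MonoidAlgebra.coeff_injective ?_
  rw [coeff_proj, MonoidAlgebra.coeff_single,
    Finsupp.filter_single_of_neg (fun n => S.bar (S.kill {x}) n = n) h]
  rfl

lemma mem_support_of_mem_support_proj {x : X} {a : MonoidAlgebra ℤ N} {n : N}
    (hn : n ∈ (S.proj x a).coeff.support) :
    n ∈ a.coeff.support ∧ S.bar (S.kill {x}) n = n := by
  classical
  rw [coeff_proj, Finsupp.support_filter] at hn
  simpa using hn

lemma ring_kill_proj_self (x : X) (a : MonoidAlgebra ℤ N) :
    S.ring (S.kill {x}) (S.proj x a) = S.proj x a :=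
  S.ring_eq_self fun _ hn => (S.mem_support_of_mem_support_proj hn).2

lemma ring_kill_proj {A : Set X} (x : X) {a : MonoidAlgebra ℤ N}
    (ha : S.ring (S.kill A) a = a) : S.ring (S.kill A) (S.proj x a) = S.proj x a :=
  S.ring_eq_self fun _ hn =>
    S.bar_kill_of_mem_support ha (S.mem_support_of_mem_support_proj hn).1

lemma proj_eq_self {x : X} {a : MonoidAlgebra ℤ N} (ha : S.ring (S.kill {x}) a = a) :
    S.proj x a = a := by
  classical
  refine MonoidAlgebra.coeff_injective ?_
  rw [coeff_proj, Finsupp.filter_eq_self_iff]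
  intro n hn
  exact S.bar_kill_of_mem_support ha (by simpa using hn)

lemma proj_of_mul {x : X} {t : N} (ht : S.bar (S.kill {x}) t = t) (a : MonoidAlgebra ℤ N) :
    S.proj x (of ℤ N t * a) = of ℤ N t * S.proj x a := by
  induction a using MonoidAlgebra.induction_linear with
  | zero => simp
  | add a b ha hb => simp only [mul_add, map_add, ha, hb]
  | single n k =>
    rw [MonoidAlgebra.of_apply, MonoidAlgebra.single_mul_single, one_mul]
    by_cases h : S.bar (S.kill {x}) n = n
    · rw [proj_single_of_eq _ h, proj_single_of_eq _ (by rw [map_mul, h, ht]),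
        MonoidAlgebra.single_mul_single, one_mul]
    · rw [proj_single_of_ne _ h, proj_single_of_ne, mul_zero]
      rw [map_mul, ht]
      simpa using h

lemma proj_ring_transvection {x y : X} (hxy : x ≠ y) {a : MonoidAlgebra ℤ N}
    (ha : S.ring (S.kill {y}) a = a) :
    S.proj y (S.ring (S.transvection x y) a) = S.proj x a := by
  have key : ∀ a, S.proj y (S.ring (S.transvection x y) (S.ring (S.kill {y}) a)) =
      S.proj x (S.ring (S.kill {y}) a) := by
    intro a
    induction a using MonoidAlgebra.induction_linear with
    | zero => simp
    | add a b ha hb => simp only [map_add, ha, hb]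
    | single n k =>
      rw [ring_single, ring_single]
      set m := S.bar (S.kill {y}) n with hm
      have hmy : S.bar (S.kill {y}) m = m := by rw [hm, bar_bar, kill_comp_self]
      by_cases h : S.bar (S.kill {x}) m = m
      · have h1 : S.bar (S.transvection x y) m = m := by
          nth_rw 1 [← h]
          rw [bar_bar, transvection_comp_kill _ _ (Set.mem_singleton x), h]
        rw [h1, proj_single_of_eq _ h, proj_single_of_eq _ hmy]
      · rw [proj_single_of_ne _ h, proj_single_of_ne]
        intro h1
        refine h (S.bar_kill_of_transvection hxy hmy (h1.symm.trans ?_))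
        have h2 : ((S.kill {y}).comp (S.transvection x y)).comp (S.kill {y}) =
            (MonoidHom.id G).comp (S.kill {y}) := by
          refine S.hom_ext fun z => ?_
          by_cases hz : z = y
          · subst hz; simp [kill_ι_of_mem]
          by_cases hx : z = x
          · subst hx; simp [kill_ι_of_mem, kill_ι_of_notMem, hz]
          · simp [kill_ι_of_notMem, hz, transvection_ι_of_ne, hx]
        rw [bar_bar, S.bar_congr h2 hmy, bar_id]
  simpa only [ha] using key a

end Proj

namespace LetterLike

variable {S} {B : Set X} {W : X → G}

lemma exists_derivative_eq_of (hW : S.LetterLike B W) (hB : B.Infinite) {b : MonoidAlgebra ℤ N}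
    (hb : ∀ x ∈ B, S.D (W x) x * b = 1) : ∃ n : N, S.bar (S.kill B) n = n ∧
    (∀ x ∈ B, S.D (W x) x = of ℤ N n) ∧ ∀ x ∈ B, S.q (W x) * n = n * S.q (S.ι x) := by
  obtain ⟨a, ha, haW, hcomm⟩ := hW.exists_derivative hB
  obtain ⟨x, hx⟩ := hB.nonempty
  have hab : a * b = 1 := haW x hx ▸ hb x hx
  have hmem : ∀ n ∈ a.coeff.support, ∀ y ∈ B, S.q (W y) * n = n * S.q (S.ι y) := by
    intro n hn y hy
    obtain ⟨z, hz, hzA⟩ := hB.exists_notMem_finset {y}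
    have hzy : y ≠ z := fun h => hzA (by simp [h])
    have h1 : (S.q (W y))⁻¹ * (n * S.q (S.ι y)) ∈ a.coeff.support := by
      have := congrArg (fun c => c.coeff (n * S.q (S.ι y))) (hcomm y hy)
      simp only [MonoidAlgebra.of_apply, MonoidAlgebra.coeff_single_mul_apply,
        MonoidAlgebra.coeff_mul_single_apply, mul_inv_cancel_right, one_mul, mul_one] at this
      rw [Finsupp.mem_support_iff] at hn ⊢
      rwa [this]
    have hya : S.ring (S.kill {y}) a = a := S.ring_kill_eq_of_subset (by simpa using hy) ha
    have h2 := S.bar_kill_of_mem_support hya hn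
    have h3 := S.bar_kill_of_mem_support hya h1
    simp only [map_mul, map_inv, bar_q, hW.kill_self hy hz hzy,
      S.kill_ι_of_mem (Set.mem_singleton y), map_one, inv_one, one_mul, mul_one, h2] at h3
    nth_rw 1 [h3]
    group
  have ha0 : a ≠ 0 := fun h => by simp [h] at hab
  obtain ⟨n₁, hn₁⟩ := Finsupp.support_nonempty_iff.mpr
    (fun h => ha0 (MonoidAlgebra.coeff_injective h))
  have hunit : ∀ n : N, of ℤ N n⁻¹ * of ℤ N n = 1 := fun n => by rw [← map_mul]; simp
  have hunit' : ∀ n : N, of ℤ N n * of ℤ N n⁻¹ = 1 := fun n => by rw [← map_mul]; simp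
  have hcentral : ∀ m ∈ (of ℤ N n₁⁻¹ * a).coeff.support, m ∈ Subgroup.center N := by
    intro m hm
    have hm' : n₁ * m ∈ a.coeff.support := by
      rw [Finsupp.mem_support_iff] at hm ⊢
      simpa using hm
    have h1 := hmem _ hm' x hx
    have hxa : S.ring (S.kill {x}) a = a := S.ring_kill_eq_of_subset (by simpa using hx) ha
    have hfix : S.bar (S.kill {x}) m = m := by
      have h2 := S.bar_kill_of_mem_support hxa hm'
      rwa [map_mul, S.bar_kill_of_mem_support hxa hn₁, mul_right_inj] at h2
    have hcomm' : S.q (S.ι x) * m = m * S.q (S.ι x) := by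
      rw [← mul_assoc, hmem _ hn₁ x hx, mul_assoc, mul_assoc, mul_right_inj] at h1
      exact h1
    rw [Subgroup.mem_center_iff]
    intro k
    obtain ⟨g, rfl⟩ := S.q_surjective k
    classical
    let μ : G →* G := S.lift (Function.update S.ι x g)
    have hμ : μ.comp (S.kill {x}) = (MonoidHom.id G).comp (S.kill {x}) := by
      refine S.hom_ext fun z => ?_
      by_cases hz : z = x
      · subst hz; simp [kill_ι_of_mem]
      · simp [kill_ι_of_notMem, hz, μ]
    have hμm : S.bar μ m = m := by rw [S.bar_congr hμ hfix, bar_id]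
    have := congrArg (S.bar μ) hcomm'
    simpa [hμm, μ] using this
  obtain ⟨n₂, e, he⟩ := MonoidAlgebra.exists_eq_single_of_mul_eq_one S.torsion_free hcentral
    (b := b * of ℤ N n₁) (by
      rw [mul_assoc, ← mul_assoc a, hab, one_mul, hunit])
  have hae : a = MonoidAlgebra.single (n₁ * n₂) e := by
    rw [← one_mul a, ← hunit', mul_assoc, he, MonoidAlgebra.of_apply,
      MonoidAlgebra.single_mul_single, one_mul]
  set n := n₁ * n₂ with hn
  have he0 : e ≠ 0 := fun h => ha0 (by rw [hae, h, MonoidAlgebra.single_zero])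
  have hnmem : n ∈ a.coeff.support := by rw [hae]; simp [he0]
  have hnfix := S.bar_kill_of_mem_support ha hnmem
  have he1 : e = 1 := by
    have hbar1 : S.bar (S.kill {x}ᶜ) n = 1 := by
      have htriv : (S.kill {x}ᶜ).comp (S.kill B) = 1 := by
        refine S.hom_ext fun z => ?_
        rw [kill_comp_kill, kill_ι_of_mem, MonoidHom.one_apply]
        by_cases hz : z = x
        · exact Or.inr (hz ▸ hx)
        · exact Or.inl hz
      rw [← hnfix, bar_bar, htriv, ← S.q_sec n, bar_q, MonoidHom.one_apply, map_one]
    have hD : S.D (S.kill {x}ᶜ (W x)) = Finsupp.single x (MonoidAlgebra.single 1 e) := by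
      ext1 c
      by_cases hc : c = x
      · subst hc
        rw [D_kill_of_notMem _ (by simp), haW c hx, hae, ring_single, hbar1,
          Finsupp.single_eq_same]
      · rw [D_kill_of_mem _ (by simpa using hc), Finsupp.single_eq_of_ne hc]
    have h := S.boundary_D (S.kill {x}ᶜ (W x))
    rw [hD] at h
    simp only [boundary, Finsupp.linearCombination_single, smul_eq_mul, mul_sub, mul_one,
      MonoidAlgebra.of_apply, MonoidAlgebra.single_mul_single, one_mul] at h
    have h1 := congrArg (fun c => MonoidAlgebra.coeff c 1) h
    simp only [MonoidAlgebra.one_def, MonoidAlgebra.coeff_sub, MonoidAlgebra.coeff_single,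
      Finsupp.sub_apply, Finsupp.single_eq_same,
      Finsupp.single_eq_of_ne (S.q_ι_ne_one x).symm] at h1
    by_cases hq : S.q (S.kill {x}ᶜ (W x)) = 1
    · rw [hq, Finsupp.single_eq_same] at h1
      omega
    · rw [Finsupp.single_eq_of_ne (Ne.symm hq)] at h1
      omega
  subst he1
  exact ⟨n, hnfix, fun y hy => (haW y hy).trans hae, fun y hy => hmem n hnmem y hy⟩

lemma conj (hW : S.LetterLike B W) {u : G} (hu : S.kill B u = u) :
    S.LetterLike B fun x => u⁻¹ * W x * u where
  kill_eq x hx := by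
    have hu' := S.kill_eq_of_subset (Set.sdiff_subset (t := {x})) hu
    rw [map_mul, map_mul, map_inv, hu', hW.kill_eq x hx]
  transvection_eq x hx y hy hxy := by
    have hu' : S.transvection x y u = u := by
      nth_rw 1 [← hu]
      rw [← MonoidHom.comp_apply, transvection_comp_kill _ _ hx, hu]
    rw [map_mul, map_mul, map_inv, hu', hW.transvection_eq x hx y hy hxy]
    group

end LetterLike

end MagnusExtension

namespace MagnusExtension

open MonoidAlgebra (of)

variable {X G N : Type*} [Group G] [Group N] {S : MagnusExtension X G N}

namespace LetterLike

variable {B : Set X} {W : X → G}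

lemma D_apply_eq_sub (hW : S.LetterLike B W) {x y c : X} (hx : x ∈ B) (hy : y ∈ B)
    (hxy : x ≠ y) (hc : c ∉ B)
    (hq : S.q (W x) = S.q (S.ι x)) :
    S.proj x (S.D (W x) c) = S.D (W x) c + of ℤ N (S.q (S.ι x)) * S.proj y (S.D (W y) c) := by
  have hcy : c ≠ y := fun h => hc (h ▸ hy)
  have hcx : c ∉ B \ {x} := fun h => hc h.1
  have hfix : S.ring (S.kill {y}) (S.D (W x) c) = S.D (W x) c :=
    S.ring_kill_eq_of_subset (by simpa using ⟨hy, hxy.symm⟩) (hW.ring_kill_D_apply hx hcx)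
  have h := congrArg (S.proj y) (hW.ring_transvection_D hx hy hxy hcy)
  rwa [S.proj_ring_transvection hxy hfix, map_add, S.proj_eq_self hfix, hq, proj_of_mul] at h
  rw [bar_q, kill_ι_of_notMem _ (by simpa using hxy)]

lemma proj_D_apply_eq (hW : S.LetterLike B W) {x y c : X} (hx : x ∈ B) (hy : y ∈ B) (hc : c ∉ B)
    (hq : S.q (W x) = S.q (S.ι x)) :
    S.proj x (S.D (W x) c) = S.proj y (S.D (W y) c) := by
  by_cases hxy : x = y
  · rw [hxy]
  have hcx : c ≠ x := fun h => hc (h ▸ hx)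
  have h := congrArg (S.ring (S.kill {x})) (hW.D_apply_eq_sub hx hy hxy hc hq)
  have h0 : S.ring (S.kill {x}) (S.D (W x) c) = 0 := by
    rw [← D_kill_of_notMem _ (by simpa using hcx), hW.kill_self hx hy hxy, D_one,
      Finsupp.zero_apply]
  have hfix : S.ring (S.kill {x}) (S.D (W y) c) = S.D (W y) c :=
    S.ring_kill_eq_of_subset (by simpa using ⟨hx, hxy⟩)
      (hW.ring_kill_D_apply hy fun h => hc h.1)
  rw [ring_kill_proj_self, map_add, h0, zero_add, map_mul, S.ring_kill_proj y hfix, ring_of,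
    bar_q, S.kill_ι_of_mem (Set.mem_singleton x), map_one, map_one, one_mul] at h
  exact h

lemma exists_conj_of_D_self_eq_one (hW : S.LetterLike B W) (hB : B.Infinite)
    (hq : ∀ x ∈ B, S.q (W x) = S.q (S.ι x))
    (hD : ∀ x ∈ B, S.D (W x) x = 1) : ∃ u, ∀ x ∈ B, W x = u * S.ι x * u⁻¹ := by
  classical
  obtain ⟨x₀, hx₀⟩ := hB.nonempty
  let β : X →₀ MonoidAlgebra ℤ N :=
    ((S.D (W x₀)).erase x₀).mapRange (S.proj x₀) (map_zero _)
  have hβB : ∀ c ∈ B, β c = 0 := by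
    intro c hc
    by_cases h : c = x₀
    · simp [β, h]
    · simp [β, h, hW.D_apply_eq_zero hx₀ hc h]
  have hβ : ∀ x ∈ B, ∀ c ∉ B, β c = S.proj x (S.D (W x) c) := by
    intro x hx c hc
    have h : c ≠ x₀ := fun h => hc (h ▸ hx₀)
    rw [← hW.proj_D_apply_eq hx₀ hx hc (hq _ hx₀)]
    simp [β, h]
  have hDW : ∀ x ∈ B, S.D (W x) = Finsupp.single x 1 + (1 - of ℤ N (S.q (S.ι x))) • β := by
    intro x hx
    ext1 c
    rw [Finsupp.add_apply, Finsupp.smul_apply, smul_eq_mul]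
    by_cases hc : c ∈ B
    · rw [hβB c hc, mul_zero, add_zero]
      by_cases h : c = x
      · rw [h, hD x hx, Finsupp.single_eq_same]
      · rw [hW.D_apply_eq_zero hx hc h, Finsupp.single_eq_of_ne h]
    · obtain ⟨y, hy, hyA⟩ := hB.exists_notMem_finset {x}
      have hxy : x ≠ y := fun h => hyA (by simp [h])
      have h := hW.D_apply_eq_sub hx hy hxy hc (hq x hx)
      rw [← hβ x hx c hc, ← hβ y hy c hc] at h
      rw [Finsupp.single_eq_of_ne (fun h : c = x => hc (h ▸ hx)), sub_mul, one_mul, zero_add]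
      exact eq_sub_of_add_eq h.symm
  have hboundary : S.boundary β = 0 := by
    refine S.eq_zero_of_of_mul_eq (x := x₀) ?_ ?_
    · rw [boundary, Finsupp.linearCombination_apply, Finsupp.sum, map_sum]
      refine Finset.sum_congr rfl fun c hc => ?_
      have hcB : c ∉ B := fun h => by simp [hβB c h] at hc
      have hcx : c ≠ x₀ := fun h => hcB (h ▸ hx₀)
      rw [smul_eq_mul, map_mul, hβ x₀ hx₀ c hcB, ring_kill_proj_self, map_sub, ring_of, bar_q,
        S.kill_ι_of_notMem (by simpa using hcx), map_one]
    · have h := S.boundary_D (W x₀)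
      rw [hDW x₀ hx₀, map_add, map_smul, hq x₀ hx₀] at h
      simp only [boundary, Finsupp.linearCombination_single, smul_eq_mul, one_mul] at h
      have := add_eq_left.mp h
      rw [sub_mul, one_mul, sub_eq_zero] at this
      exact this.symm
  obtain ⟨r, hr, hrD⟩ := S.exists_D_eq β hboundary
  refine ⟨r, fun x hx => S.eq_of_D_eq ?_ ?_⟩
  · rw [map_mul, map_mul, map_inv, hr, hq x hx]
    simp
  · rw [D_mul, D_mul, D_inv, hr, hrD, hDW x hx, map_mul, hr, S.D_ι, sub_smul, one_mul, inv_one,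
      map_one, one_smul, one_smul, smul_neg]
    abel

/-- A letter-like family with invertible derivatives is conjugate to the family of letters. -/
lemma exists_conj (hW : S.LetterLike B W) (hB : B.Infinite) {b : MonoidAlgebra ℤ N}
    (hb : ∀ x ∈ B, S.D (W x) x * b = 1) : ∃ u, ∀ x ∈ B, W x = u * S.ι x * u⁻¹ := by
  obtain ⟨n, hn, hD, hq⟩ := hW.exists_derivative_eq_of hB hb
  let v := S.kill B (S.sec n)
  have hv : S.kill B v = v := by rw [kill_kill, Set.union_self]
  have hqv : S.q v = n := by rw [← bar_q, q_sec, hn]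
  obtain ⟨u, hu⟩ := (hW.conj hv).exists_conj_of_D_self_eq_one hB
    (fun x hx => by
      rw [map_mul, map_mul, map_inv, hqv, mul_assoc, hq x hx, inv_mul_cancel_left])
    (fun x hx => by
      have h1 : S.D v x = 0 := S.D_apply_eq_zero hv hx
      rw [D_mul, D_mul, D_inv, hqv, Finsupp.add_apply, Finsupp.add_apply, Finsupp.neg_apply,
        Finsupp.smul_apply, Finsupp.smul_apply, Finsupp.smul_apply, h1, hD x hx, smul_zero,
        smul_zero, neg_zero, zero_add, add_zero, smul_eq_mul, map_inv S.q, hqv, ← map_mul,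
        inv_mul_cancel, map_one])
  refine ⟨v * u, fun x hx => ?_⟩
  have := hu x hx
  rw [mul_assoc, inv_mul_eq_iff_eq_mul, ← eq_mul_inv_iff_mul_eq] at this
  rw [this]
  group

end LetterLike

/-- An automorphism mapping the letters from `B` to a letter-like family, and whose inverse has
the same property, acts on these letters as an inner automorphism. -/
lemma exists_conj_of_letterLike {B : Set X} (hB : B.Infinite) (φ : MulAut G)
    (hφ : S.LetterLike B fun x => φ (S.ι x)) (hφ' : S.LetterLike B fun x => φ⁻¹ (S.ι x))
    (hout : ∀ z ∉ B, S.kill B (φ⁻¹ (S.ι z)) = φ⁻¹ (S.ι z)) :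
    ∃ u, ∀ x ∈ B, φ (S.ι x) = u * S.ι x * u⁻¹ := by
  obtain ⟨a, -, ha, -⟩ := hφ.exists_derivative hB
  obtain ⟨a', -, ha', -⟩ := hφ'.exists_derivative hB
  refine hφ.exists_conj hB (b := S.ring φ.toMonoidHom a') fun x hx => ?_
  have h := S.D_map_apply_eq (φ⁻¹ : MulAut G).toMonoidHom (φ (S.ι x)) x fun c hc => by
    by_cases hcB : c ∈ B
    · exact hφ'.D_apply_eq_zero hcB hx hc.symm
    · exact S.D_apply_eq_zero (hout c hcB) hx
  have h1 : (φ⁻¹ : MulAut G).toMonoidHom (φ (S.ι x)) = S.ι x := φ.symm_apply_apply _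
  have h2 : S.D ((φ⁻¹ : MulAut G).toMonoidHom (S.ι x)) x = a' := ha' x hx
  rw [h1, S.D_ι, Finsupp.single_eq_same, ha x hx, h2] at h
  have h3 := congrArg (S.ring φ.toMonoidHom) h
  have h4 : φ.toMonoidHom.comp (φ⁻¹ : MulAut G).toMonoidHom = MonoidHom.id G :=
    MonoidHom.ext fun g => φ.apply_symm_apply g
  rw [map_one, map_mul, ring_ring, h4, ring_id] at h3
  rw [ha x hx, ← h3]

end MagnusExtension

/-- The conjugacy class of `a` has at most as many elements as `X`. -/
def HasSmallClass (X : Type*) {A : Type*} [Group A] (a : A) : Prop :=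
  ∃ f : X → A, ∀ g : A, ∃ x, f x = g * a * g⁻¹

namespace HasSmallClass

variable {X A : Type*} [Group A] {a b : A}

lemma map {A' : Type*} [Group A'] (e : A ≃* A') (h : HasSmallClass X a) :
    HasSmallClass X (e a) := by
  obtain ⟨f, hf⟩ := h
  refine ⟨fun x => e (f x), fun g => ?_⟩
  obtain ⟨x, hx⟩ := hf (e.symm g)
  exact ⟨x, by simp [hx]⟩

lemma inv (h : HasSmallClass X a) : HasSmallClass X a⁻¹ := by
  obtain ⟨f, hf⟩ := h
  refine ⟨fun x => (f x)⁻¹, fun g => ?_⟩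
  obtain ⟨x, hx⟩ := hf g
  exact ⟨x, by simp only [hx]; group⟩

lemma mul [Infinite X] (ha : HasSmallClass X a) (hb : HasSmallClass X b) :
    HasSmallClass X (a * b) := by
  obtain ⟨f, hf⟩ := ha
  obtain ⟨f', hf'⟩ := hb
  obtain ⟨e⟩ : Nonempty (X ≃ X × X) := Cardinal.eq.mp (by simp [Cardinal.mul_eq_self])
  refine ⟨fun x => f (e x).1 * f' (e x).2, fun g => ?_⟩
  obtain ⟨x, hx⟩ := hf g
  obtain ⟨y, hy⟩ := hf' g
  exact ⟨e.symm (x, y), by simp only [Equiv.apply_symm_apply, hx, hy]; group⟩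

lemma conj (h : HasSmallClass X a) (g : A) : HasSmallClass X (g * a * g⁻¹) :=
  h.map (MulAut.conj g)

lemma mulAut_conj {G : Type*} [Group G] {s : X → G} (hs : Function.Surjective s) (g : G) :
    HasSmallClass X (MulAut.conj g) := by
  refine ⟨fun x => MulAut.conj (s x), fun φ => ?_⟩
  obtain ⟨x, hx⟩ := hs (φ g)
  exact ⟨x, by ext h; simp [hx]⟩

/-- A diagonal argument: an element with small conjugacy class cannot be moved by all coordinates
of a large power of a group. -/
lemma exists_forall_commute {P : Type*} [Group P] (h : HasSmallClass X a) (Δ : (X → P) →* A) :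
    ∃ α, ∀ π, ∃ q, q α = π ∧ Commute (Δ q) a := by
  obtain ⟨f, hf⟩ := h
  by_contra! hne
  choose π hπ using hne
  have hg : ∀ α, ∃ g : X → P, (∃ g', f α = Δ g' * a * (Δ g')⁻¹) → f α = Δ g * a * (Δ g)⁻¹ := by
    intro α
    by_cases h : ∃ g', f α = Δ g' * a * (Δ g')⁻¹
    · exact ⟨h.choose, fun _ => h.choose_spec⟩
    · exact ⟨1, fun h' => (h h').elim⟩
  choose g hg using hg
  obtain ⟨α, hα⟩ := hf (Δ fun α => g α α * π α)
  have h1 := hα.symm.trans (hg α ⟨_, hα⟩)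
  refine hπ α ((g α)⁻¹ * fun α => g α α * π α) (by simp) ?_
  rw [map_mul, map_inv]
  generalize (Δ fun α => g α α * π α) = u at h1 ⊢
  rw [mul_inv_eq_iff_eq_mul] at h1
  rw [commute_iff_eq, mul_assoc, h1]
  group

end HasSmallClass

/-- Every point is the fixed point of a commutator of permutations whose powers move every finite
set off itself, up to that point. -/
lemma Equiv.Perm.exists_commutator_forall_finset {X : Type*} [Infinite X] (x₀ : X) :
    ∃ s r : Equiv.Perm X, ⁅s, r⁆ x₀ = x₀ ∧
      ∀ A : Finset X, ∃ n : ℕ, ∀ a ∈ A, a ≠ x₀ → (⁅s, r⁆ ^ n) a ∉ A := by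
  classical
  obtain ⟨e₀⟩ : Nonempty (X ≃ Option (X × ℤ)) := Cardinal.eq.mp (by
    rw [Cardinal.mk_option, Cardinal.mk_prod, Cardinal.mk_int, Cardinal.lift_uzero,
      Cardinal.lift_aleph0, Cardinal.mul_aleph0_eq (Cardinal.aleph0_le_mk X),
      Cardinal.add_one_eq (Cardinal.aleph0_le_mk X)])
  let e : X ≃ Option (X × ℤ) := e₀.trans (Equiv.swap (e₀ x₀) none)
  have he : e x₀ = none := by simp [e]
  let s' : Equiv.Perm (Option (X × ℤ)) :=
    Equiv.optionCongr ((Equiv.refl X).prodCongr (Equiv.addRight 1))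
  let r' : Equiv.Perm (Option (X × ℤ)) :=
    Equiv.optionCongr ((Equiv.refl X).prodCongr (Equiv.neg ℤ))
  have hnone : ⁅s', r'⁆ none = none := rfl
  have hsome : ∀ x n, ⁅s', r'⁆ (some (x, n)) = some (x, n + 2) := by
    intro x n
    have : ⁅s', r'⁆ (some (x, n)) = some (x, -(-n + -1) + 1) := rfl
    rw [this]
    congr 2
    ring
  have hpow : ∀ (k : ℕ) x n, (⁅s', r'⁆ ^ k) (some (x, n)) = some (x, n + 2 * k) := by
    intro k
    induction k with
    | zero => simp
    | succ k ih =>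
      intro x n
      rw [pow_succ, Equiv.Perm.mul_apply, hsome, ih]
      congr 2
      push_cast
      ring
  let c := e.symm.permCongrHom
  have hc : ∀ p x, c p x = e.symm (p (e x)) := fun p x => rfl
  refine ⟨c s', c r', ?_, fun A => ?_⟩
  · rw [← map_commutatorElement, hc, he, hnone, ← he, Equiv.symm_apply_apply]
  · obtain ⟨M, hM⟩ : ∃ M : ℕ, ∀ a ∈ A, ∀ x n, e a = some (x, n) → n.natAbs ≤ M := by
      refine ⟨A.sup fun a => ((e a).map fun p => p.2.natAbs).getD 0, fun a ha x n h => ?_⟩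
      have := Finset.le_sup (f := fun a => ((e a).map fun p => p.2.natAbs).getD 0) ha
      simpa [h] using this
    refine ⟨M + 1, fun a ha hax h => ?_⟩
    rw [← map_commutatorElement, ← map_pow, hc] at h
    obtain ⟨⟨x, n⟩, hxn⟩ : ∃ p, e a = some p :=
      Option.ne_none_iff_exists'.mp fun h => hax (e.injective (h.trans he.symm))
    rw [hxn, hpow] at h
    have h1 := hM a ha x n hxn
    have h2 := hM _ h x _ (Equiv.apply_symm_apply _ _)
    omega

namespace MagnusExtension

variable {X G N : Type*} [Group G] [Group N] (S : MagnusExtension X G N)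

/-- Two mutually inverse endomorphisms, given on letters, form an automorphism. -/
noncomputable def autOf (f g : X → G) (hfg : ∀ x, S.lift f (g x) = S.ι x)
    (hgf : ∀ x, S.lift g (f x) = S.ι x) : MulAut G :=
  MonoidHom.toMulEquiv (S.lift f) (S.lift g)
    (S.hom_ext fun x => by simp [hgf]) (S.hom_ext fun x => by simp [hfg])

@[simp]
lemma autOf_ι (f g : X → G) (hfg hgf) (x : X) : S.autOf f g hfg hgf (S.ι x) = f x := by
  simp [autOf]

lemma mulAut_ext {φ ψ : MulAut G} (h : ∀ x, φ (S.ι x) = ψ (S.ι x)) : φ = ψ :=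
  MulEquiv.toMonoidHom_injective (S.hom_ext h)

section Block

variable {α : Type*} (j : α → X → X)

open Classical in
/-- The values on letters of the endomorphism acting on every block `j a` as a copy of `q a`. -/
noncomputable def blockFun (q : α → MulAut G) (z : X) : G :=
  if h : ∃ a x, j a x = z then S.lift (S.ι ∘ j h.choose) (q h.choose (S.ι h.choose_spec.choose))
  else S.ι z

variable {j}

lemma blockFun_block (hj : Function.Injective2 j) (q : α → MulAut G) (a : α) (x : X) :
    S.blockFun j q (j a x) = S.lift (S.ι ∘ j a) (q a (S.ι x)) := by
  have h : ∃ b y, j b y = j a x := ⟨a, x, rfl⟩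
  obtain ⟨h1, h2⟩ := hj h.choose_spec.choose_spec
  rw [blockFun, dif_pos h, h2, h1]

lemma blockFun_of_notMem (q : α → MulAut G) {z : X} (hz : ∀ a x, j a x ≠ z) :
    S.blockFun j q z = S.ι z := by
  rw [blockFun, dif_neg]
  simpa using hz

lemma lift_blockFun_lift (hj : Function.Injective2 j) (q : α → MulAut G) (a : α) (g : G) :
    S.lift (S.blockFun j q) (S.lift (S.ι ∘ j a) g) = S.lift (S.ι ∘ j a) (q a g) := by
  have : (S.lift (S.blockFun j q)).comp (S.lift (S.ι ∘ j a)) =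
      (S.lift (S.ι ∘ j a)).comp (q a).toMonoidHom :=
    S.hom_ext fun x => by simp [S.blockFun_block hj]
  exact DFunLike.congr_fun this g

lemma lift_blockFun_blockFun_inv (hj : Function.Injective2 j) (q : α → MulAut G) (x : X) :
    S.lift (S.blockFun j q) (S.blockFun j q⁻¹ x) = S.ι x := by
  by_cases h : ∃ a y, j a y = x
  · obtain ⟨a, y, rfl⟩ := h
    rw [blockFun_block _ hj, lift_blockFun_lift _ hj]
    simp
  · push Not at h
    rw [S.blockFun_of_notMem _ h, lift_ι, S.blockFun_of_notMem _ h]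

/-- The automorphism acting on every block `j a` of letters as a copy of `q a`. -/
noncomputable def blockAut (hj : Function.Injective2 j) : (α → MulAut G) →* MulAut G :=
  MonoidHom.mk' (fun q => S.autOf (S.blockFun j q) (S.blockFun j q⁻¹)
    (S.lift_blockFun_blockFun_inv hj q)
    (fun x => by simpa using S.lift_blockFun_blockFun_inv hj q⁻¹ x)) fun q r => by
      refine S.mulAut_ext fun x => ?_
      rw [MulAut.mul_apply, autOf_ι, autOf_ι]
      change _ = S.lift (S.blockFun j q) _
      by_cases h : ∃ a y, j a y = x
      · obtain ⟨a, y, rfl⟩ := h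
        rw [S.blockFun_block hj, S.blockFun_block hj, S.lift_blockFun_lift hj]
        rfl
      · push Not at h
        rw [S.blockFun_of_notMem _ h, S.blockFun_of_notMem _ h, lift_ι, S.blockFun_of_notMem _ h]

lemma blockAut_ι (hj : Function.Injective2 j) (q : α → MulAut G) (z : X) :
    S.blockAut hj q (S.ι z) = S.blockFun j q z :=
  S.lift_ι (S.blockFun j q) z

lemma blockAut_block (hj : Function.Injective2 j) (q : α → MulAut G) (a : α) (x : X) :
    S.blockAut hj q (S.ι (j a x)) = S.lift (S.ι ∘ j a) (q a (S.ι x)) := by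
  rw [blockAut_ι, S.blockFun_block hj]

lemma blockAut_of_notMem (hj : Function.Injective2 j) (q : α → MulAut G) {z : X}
    (hz : ∀ a x, j a x ≠ z) :
    S.blockAut hj q (S.ι z) = S.ι z := by
  rw [blockAut_ι, S.blockFun_of_notMem q hz]

end Block

section Extend

variable {i : X → X} (hi : Function.Injective i)

/-- The automorphism acting on the letters `i x` as a copy of a given automorphism, and trivially
on the other letters. -/
noncomputable def extend : MulAut G →* MulAut G :=
  (S.blockAut (α := Unit) (j := fun _ => i) fun _ _ _ _ h => ⟨rfl, hi h⟩).comp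
    (MonoidHom.mk' (fun π _ => π) fun _ _ => rfl)

lemma extend_apply_ι (π : MulAut G) (x : X) :
    S.extend hi π (S.ι (i x)) = S.lift (S.ι ∘ i) (π (S.ι x)) :=
  S.blockAut_block (fun _ _ _ _ h => ⟨rfl, hi h⟩) _ () x

lemma extend_of_notMem (π : MulAut G) {z : X} (hz : ∀ x, i x ≠ z) :
    S.extend hi π (S.ι z) = S.ι z :=
  S.blockAut_of_notMem (fun _ _ _ _ h => ⟨rfl, hi h⟩) _ fun _ x => hz x

lemma lift_comp_lift {i k : X → X} (g : G) :
    S.lift (S.ι ∘ i) (S.lift (S.ι ∘ k) g) = S.lift (S.ι ∘ i ∘ k) g := by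
  have : (S.lift (S.ι ∘ i)).comp (S.lift (S.ι ∘ k)) = S.lift (S.ι ∘ i ∘ k) :=
    S.hom_ext fun x => by simp
  exact DFunLike.congr_fun this g

lemma extend_extend {k : X → X} (hk : Function.Injective k) (π : MulAut G) :
    S.extend hi (S.extend hk π) = S.extend (hi.comp hk) π := by
  refine S.mulAut_ext fun z => ?_
  by_cases hz : ∃ x, i x = z
  · obtain ⟨x, rfl⟩ := hz
    rw [extend_apply_ι]
    by_cases hx : ∃ y, k y = x
    · obtain ⟨y, rfl⟩ := hx
      rw [extend_apply_ι, lift_comp_lift]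
      exact (S.extend_apply_ι (hi.comp hk) π y).symm
    · push Not at hx
      rw [S.extend_of_notMem _ _ hx, S.extend_of_notMem (hi.comp hk) _ fun y h => hx y (hi h)]
      simp
  · push Not at hz
    rw [S.extend_of_notMem _ _ hz, S.extend_of_notMem _ _ fun x => hz (k x)]

variable {α : Type*} {j : α → X → X} (hj : Function.Injective2 j)

lemma blockAut_mulSingle [DecidableEq α] (a : α) (π : MulAut G) :
    S.blockAut hj (Pi.mulSingle a π) = S.extend (hj.right a) π := by
  refine S.mulAut_ext fun z => ?_
  by_cases hz : ∃ b x, j b x = z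
  · obtain ⟨b, x, rfl⟩ := hz
    rw [blockAut_block]
    by_cases hb : b = a
    · subst hb
      rw [Pi.mulSingle_eq_same, extend_apply_ι]
    · rw [Pi.mulSingle_eq_of_ne hb, S.extend_of_notMem _ _ fun y h => hb (hj h).1.symm]
      simp
  · push Not at hz
    rw [S.blockAut_of_notMem _ _ hz, S.extend_of_notMem _ _ (hz a)]

lemma extend_blockAut (q : α → MulAut G) (hij : Function.Injective2 fun a x => i (j a x)) :
    S.extend hi (S.blockAut hj q) = S.blockAut hij q := by
  refine S.mulAut_ext fun z => ?_
  by_cases hz : ∃ x, i x = z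
  · obtain ⟨x, rfl⟩ := hz
    rw [extend_apply_ι]
    by_cases hx : ∃ a y, j a y = x
    · obtain ⟨a, y, rfl⟩ := hx
      rw [blockAut_block, lift_comp_lift, S.blockAut_block hij]
      rfl
    · push Not at hx
      rw [S.blockAut_of_notMem _ _ hx, S.blockAut_of_notMem hij _ fun a y h => hx a y (hi h)]
      simp
  · push Not at hz
    rw [S.extend_of_notMem _ _ hz, S.blockAut_of_notMem _ _ fun a x => hz (j a x)]

end Extend

/-- An automorphism with small conjugacy class commutes with the extended commutators
from a copy of the automorphism group. -/
lemma exists_commute_extend [Infinite X] {φ : MulAut G} (hφ : HasSmallClass X φ) {s : X → X}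
    (hs : Function.Injective s) : ∃ (i : X → X) (hi : Function.Injective i),
      Set.range i ⊆ Set.range s ∧ ∀ π π' : MulAut G, Commute (S.extend hi ⁅π, π'⁆) φ := by
  classical
  obtain ⟨e⟩ : Nonempty (X × X ≃ X) := Cardinal.eq.mp (by simp [Cardinal.mul_eq_self])
  have hcurry : ∀ {k : X → X}, Function.Injective k → Function.Injective2 fun a x => k (e (a, x)) :=
    fun hk a b x y h => by simpa using e.injective (hk h)
  obtain ⟨α, hα⟩ := hφ.exists_forall_commute (S.blockAut (hcurry hs))
  have hsα := (hcurry hs).right α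
  obtain ⟨β, hβ⟩ := hφ.exists_forall_commute (S.blockAut (hcurry hsα))
  have he := hcurry Function.injective_id
  refine ⟨_, (hcurry hsα).right β, ?_, fun π π' => ?_⟩
  · rintro _ ⟨x, rfl⟩
    exact ⟨_, rfl⟩
  obtain ⟨q', hq', hcomm'⟩ := hβ π'
  obtain ⟨q, hq, hcomm⟩ := hα (S.blockAut he (Pi.mulSingle β π))
  have hsingle : ∀ (a : X) (u v : X → MulAut G), ⁅u, v⁆ a = ⁅u a, v a⁆ := fun a u v => rfl
  have h1 : S.blockAut (hcurry hsα) q' =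
      S.blockAut (hcurry hs) (Pi.mulSingle α (S.blockAut he q')) := by
    rw [blockAut_mulSingle]
    exact (S.extend_blockAut hsα he q' (hcurry hsα)).symm
  have h2 : ⁅q, Pi.mulSingle α (S.blockAut he q')⁆ =
      (Pi.mulSingle α (S.blockAut he (Pi.mulSingle β ⁅π, π'⁆)) : X → MulAut G) := by
    ext1 a
    rw [hsingle]
    by_cases ha : a = α
    · subst ha
      rw [Pi.mulSingle_eq_same, Pi.mulSingle_eq_same, hq, ← map_commutatorElement]
      congr 1
      ext1 b
      rw [hsingle]
      by_cases hb : b = β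
      · subst hb
        rw [Pi.mulSingle_eq_same, Pi.mulSingle_eq_same, hq']
      · rw [Pi.mulSingle_eq_of_ne hb, Pi.mulSingle_eq_of_ne hb, commutatorElement_one_left]
    · rw [Pi.mulSingle_eq_of_ne ha, Pi.mulSingle_eq_of_ne ha, commutatorElement_one_right]
  have h3 : S.extend ((hcurry hsα).right β) ⁅π, π'⁆ =
      ⁅S.blockAut (hcurry hs) q, S.blockAut (hcurry hsα) q'⁆ := by
    rw [h1, ← map_commutatorElement, h2, blockAut_mulSingle, blockAut_mulSingle, extend_extend]
  rw [h3, commutatorElement_def]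
  exact ((hcomm.mul_left hcomm').mul_left hcomm.inv_left).mul_left hcomm'.inv_left

end MagnusExtension

namespace MagnusExtension

variable {X G N : Type*} [Group G] [Group N] (S : MagnusExtension X G N)

/-- The action of permutations of the letters. -/
noncomputable def permAut : Equiv.Perm X →* MulAut G :=
  MonoidHom.mk' (fun σ => S.autOf (fun x => S.ι (σ x)) (fun x => S.ι (σ⁻¹ x)) (by simp) (by simp))
    fun σ τ => S.mulAut_ext fun x => by simp

@[simp]
lemma permAut_ι (σ : Equiv.Perm X) (x : X) : S.permAut σ (S.ι x) = S.ι (σ x) :=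
  S.lift_ι _ x

open Classical in
lemma lift_mul_mul_eq_self {B : Set X} {g : G} (hg : S.kill B g = g) (l r : G) :
    S.lift (fun x => if x ∈ B then l * S.ι x * r else S.ι x) g = g := by
  have : (S.lift fun x => if x ∈ B then l * S.ι x * r else S.ι x).comp (S.kill B) =
      (MonoidHom.id G).comp (S.kill B) := by
    refine S.hom_ext fun x => ?_
    by_cases hx : x ∈ B
    · simp [kill_ι_of_mem, hx]
    · simp [kill_ι_of_notMem, hx]
  nth_rw 1 [← hg]
  exact (DFunLike.congr_fun this g).trans hg

open Classical in
/-- The automorphism `x ↦ l * x * r` for `x ∈ B` fixing the other letters; here `l` and `r` must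
not involve letters from `B`. -/
noncomputable def mulAut {B : Set X} {l r : G} (hl : S.kill B l = l) (hr : S.kill B r = r) :
    MulAut G :=
  S.autOf (fun x => if x ∈ B then l * S.ι x * r else S.ι x)
    (fun x => if x ∈ B then l⁻¹ * S.ι x * r⁻¹ else S.ι x)
    (fun x => by
      by_cases hx : x ∈ B
      · simp only [hx, if_true, map_mul, map_inv, S.lift_mul_mul_eq_self hl,
          S.lift_mul_mul_eq_self hr, lift_ι]
        group
      · simp [hx])
    (fun x => by
      by_cases hx : x ∈ B
      · simp only [hx, if_true, map_mul, S.lift_mul_mul_eq_self hl,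
          S.lift_mul_mul_eq_self hr, lift_ι]
        group
      · simp [hx])

section mulAut

variable {B : Set X} {l r : G} (hl : S.kill B l = l) (hr : S.kill B r = r)

lemma mulAut_ι_of_mem {x : X} (hx : x ∈ B) : S.mulAut hl hr (S.ι x) = l * S.ι x * r := by
  simp [mulAut, hx]

lemma mulAut_ι_of_notMem {x : X} (hx : x ∉ B) : S.mulAut hl hr (S.ι x) = S.ι x := by
  simp [mulAut, hx]

lemma mulAut_inv_ι_of_mem {x : X} (hx : x ∈ B) :
    (S.mulAut hl hr)⁻¹ (S.ι x) = l⁻¹ * S.ι x * r⁻¹ :=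
  (S.lift_ι _ x).trans (if_pos hx)

lemma mulAut_inv_ι_of_notMem {x : X} (hx : x ∉ B) : (S.mulAut hl hr)⁻¹ (S.ι x) = S.ι x :=
  (S.lift_ι _ x).trans (if_neg hx)

end mulAut

/-- Transvections are commutators of automorphisms. -/
lemma exists_commutator_eq_transvection [Infinite X] {x y : X} (hxy : x ≠ y) :
    ∃ π π' : MulAut G, ∀ z, ⁅π, π'⁆ (S.ι z) = S.transvection x y (S.ι z) := by
  classical
  obtain ⟨u, hu⟩ := Infinite.exists_notMem_finset ({x, y} : Finset X)
  simp only [Finset.mem_insert, Finset.mem_singleton, not_or] at hu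
  obtain ⟨hux, huy⟩ := hu
  have h1 : ∀ A : Set X, S.kill A 1 = 1 := fun A => map_one _
  have hx : x ∈ ({x} : Set X) := rfl
  have hu : u ∈ ({u} : Set X) := rfl
  have hyx : y ∉ ({x} : Set X) := hxy.symm
  have hyu : y ∉ ({u} : Set X) := Ne.symm huy
  have hux' : u ∉ ({x} : Set X) := hux
  have hxu : x ∉ ({u} : Set X) := Ne.symm hux
  have h2 : S.kill {x} (S.ι u) = S.ι u := S.kill_ι_of_notMem hux'
  have h3 : S.kill {u} (S.ι y)⁻¹ = (S.ι y)⁻¹ := by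
    rw [map_inv, S.kill_ι_of_notMem hyu]
  refine ⟨S.mulAut (h1 {x}) h2, S.mulAut h3 (h1 {u}), fun z => ?_⟩
  simp only [commutatorElement_def, MulAut.mul_apply]
  by_cases hzx : z = x
  · subst hzx
    simp only [S.mulAut_inv_ι_of_notMem _ _ hxu, S.mulAut_inv_ι_of_mem _ _ hx,
      S.mulAut_ι_of_notMem _ _ hxu, S.mulAut_ι_of_mem _ _ hx,
      S.mulAut_ι_of_mem _ _ hu, S.mulAut_ι_of_notMem _ _ hux', S.mulAut_ι_of_notMem _ _ hyx,
      map_mul, map_inv, inv_one, one_mul, mul_one, transvection_ι_self]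
    group
  rw [S.transvection_ι_of_ne _ hzx]
  by_cases hzu : z = u
  · subst hzu
    simp only [S.mulAut_inv_ι_of_mem _ _ hu, S.mulAut_ι_of_mem _ _ hu,
      S.mulAut_ι_of_notMem _ _ hux', S.mulAut_inv_ι_of_notMem _ _ hux',
      S.mulAut_ι_of_notMem _ _ hyx, S.mulAut_inv_ι_of_notMem _ _ hyx,
      S.mulAut_ι_of_notMem _ _ hyu, map_mul, map_inv, inv_one, mul_one]
    group
  · have hzx' : z ∉ ({x} : Set X) := hzx
    have hzu' : z ∉ ({u} : Set X) := hzu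
    rw [S.mulAut_inv_ι_of_notMem _ _ hzu', S.mulAut_inv_ι_of_notMem _ _ hzx',
      S.mulAut_ι_of_notMem _ _ hzu', S.mulAut_ι_of_notMem _ _ hzx']

section Commute

variable {i : X → X} (hi : Function.Injective i)

/-- Elements fixed by all extended commutators which fix the letter `i x₀` do not involve
the letters `i x` with `x ≠ x₀`. -/
lemma kill_range_diff_eq [Infinite X] {g : G} (x₀ : X)
    (hg : ∀ π π' : MulAut G, ⁅π, π'⁆ (S.ι x₀) = S.ι x₀ → S.extend hi ⁅π, π'⁆ g = g) :
    S.kill (Set.range i \ {i x₀}) g = g := by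
  classical
  obtain ⟨s, r, hsr, hpow⟩ := Equiv.Perm.exists_commutator_forall_finset x₀
  obtain ⟨A, hA⟩ := S.exists_finset g
  obtain ⟨n, hn⟩ := hpow (A.preimage i hi.injOn)
  have hfix : ∀ k : ℕ, S.extend hi (S.permAut (⁅s, r⁆ ^ k)) g = g := by
    intro k
    induction k with
    | zero => simp
    | succ k ih =>
      rw [pow_succ, map_mul, map_mul, MulAut.mul_apply, map_commutatorElement, hg, ih]
      rw [← map_commutatorElement, permAut_ι, hsr]
  set K := S.kill ((A : Set X) ∩ (Set.range i \ {i x₀})) with hK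
  have h1 : K g = g := by
    rw [← hfix n]
    refine hA (K.comp (S.extend hi (S.permAut (⁅s, r⁆ ^ n))).toMonoidHom)
      (S.extend hi (S.permAut (⁅s, r⁆ ^ n))).toMonoidHom fun a ha => ?_
    change K (S.extend hi _ (S.ι a)) = S.extend hi _ (S.ι a)
    by_cases hai : ∃ x, i x = a
    · obtain ⟨x, rfl⟩ := hai
      rw [extend_apply_ι, permAut_ι, lift_ι]
      refine S.kill_ι_of_notMem fun h => ?_
      have hx : x ≠ x₀ := by
        rintro rfl
        refine h.2.2 ?_
        have : ∀ k : ℕ, (⁅s, r⁆ ^ k) x = x := fun k =>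
          Function.IsFixedPt.perm_pow hsr k
        simp [this]
      exact hn x (by simpa using ha) hx (by simpa using h.1)
    · push Not at hai
      rw [S.extend_of_notMem _ _ hai]
      exact S.kill_ι_of_notMem fun h => h.2.1.elim hai
  rw [hA _ K fun a ha => ?_, h1]
  by_cases hb : a ∈ Set.range i \ {i x₀}
  · rw [S.kill_ι_of_mem hb, hK, S.kill_ι_of_mem (A := A ∩ (Set.range i \ {i x₀})) ⟨ha, hb⟩]
  · rw [S.kill_ι_of_notMem hb, hK, S.kill_ι_of_notMem fun h => hb h.2]

lemma letterLike_of_commute [Infinite X] {φ : MulAut G}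
    (h : ∀ π π' : MulAut G, Commute (S.extend hi ⁅π, π'⁆) φ) :
    S.LetterLike (Set.range i) fun x => φ (S.ι x) where
  kill_eq := by
    rintro _ ⟨x, rfl⟩
    refine S.kill_range_diff_eq hi x fun π π' hx => ?_
    rw [← MulAut.mul_apply, (h π π').eq, MulAut.mul_apply, extend_apply_ι, hx, lift_ι]
    rfl
  transvection_eq := by
    rintro _ ⟨x, rfl⟩ _ ⟨y, rfl⟩ hxy
    obtain ⟨π, π', hπ⟩ := S.exists_commutator_eq_transvection fun h : x = y => hxy (congrArg i h)
    have h1 : (S.extend hi ⁅π, π'⁆).toMonoidHom = S.transvection (i x) (i y) := by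
      refine S.hom_ext fun z => ?_
      change S.extend hi _ _ = _
      by_cases hz : ∃ t, i t = z
      · obtain ⟨t, rfl⟩ := hz
        rw [extend_apply_ι, hπ]
        by_cases htx : t = x
        · subst htx; simp
        · rw [S.transvection_ι_of_ne _ htx, S.transvection_ι_of_ne _ fun h => htx (hi h)]
          simp
      · push Not at hz
        rw [S.extend_of_notMem _ _ hz, S.transvection_ι_of_ne _ (hz x).symm]
    have h2 := DFunLike.congr_fun (h π π').eq (S.ι (i x))
    rw [MulAut.mul_apply, MulAut.mul_apply] at h2
    rw [← h1]
    refine h2.trans ?_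
    rw [← map_mul, ← S.transvection_ι_self, ← h1]
    rfl

lemma kill_range_eq_of_commute [Infinite X] {φ : MulAut G}
    (h : ∀ π π' : MulAut G, Commute (S.extend hi ⁅π, π'⁆) φ) {z : X} (hz : z ∉ Set.range i) :
    S.kill (Set.range i) (φ (S.ι z)) = φ (S.ι z) := by
  have key : ∀ x, S.kill (Set.range i \ {i x}) (φ (S.ι z)) = φ (S.ι z) := fun x => by
    refine S.kill_range_diff_eq hi x fun π π' _ => ?_
    rw [← MulAut.mul_apply, (h π π').eq, MulAut.mul_apply,
      S.extend_of_notMem _ _ fun t ht => hz ⟨t, ht⟩]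
  obtain ⟨x, y, hxy⟩ := exists_pair_ne X
  have := S.kill_eq_of_forall_mem (key x) (key y)
  rwa [← Set.sdiff_inter, Set.singleton_inter_eq_empty.mpr (by simpa using fun h => hxy (hi h)),
    Set.sdiff_empty] at this

end Commute

/-- An automorphism with small conjugacy class acts on infinitely many letters as an inner
automorphism. -/
lemma exists_letterLike [Infinite X] {φ : MulAut G} (hφ : HasSmallClass X φ) {s : X → X}
    (hs : Function.Injective s) : ∃ i : X → X, Function.Injective i ∧ Set.range i ⊆ Set.range s ∧
      (S.LetterLike (Set.range i) fun x => φ (S.ι x)) ∧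
      ∃ u, ∀ x, φ (S.ι (i x)) = u * S.ι (i x) * u⁻¹ := by
  obtain ⟨i, hi, his, h⟩ := S.exists_commute_extend hφ hs
  have h' : ∀ π π' : MulAut G, Commute (S.extend hi ⁅π, π'⁆) φ⁻¹ := fun π π' =>
    (h π π').inv_right
  have hB : (Set.range i).Infinite := Set.infinite_range_of_injective hi
  obtain ⟨u, hu⟩ := S.exists_conj_of_letterLike hB φ (S.letterLike_of_commute hi h)
    (S.letterLike_of_commute hi h') fun z hz => S.kill_range_eq_of_commute hi h' hz
  exact ⟨i, hi, his, S.letterLike_of_commute hi h, u, fun x => hu _ ⟨x, rfl⟩⟩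

/-- An automorphism with small conjugacy class fixing infinitely many letters is trivial. -/
lemma eq_one_of_hasSmallClass [Infinite X] {φ : MulAut G} (hφ : HasSmallClass X φ) {i : X → X}
    (hi : Function.Injective i) (hfix : ∀ x, φ (S.ι (i x)) = S.ι (i x)) : φ = 1 := by
  classical
  refine S.mulAut_ext fun z => ?_
  by_cases hz : ∃ x, i x = z
  · obtain ⟨x, rfl⟩ := hz
    exact hfix x
  have hz' : z ∉ Set.range i := hz
  let g := S.mulAut (map_one (S.kill (Set.range i))) (S.kill_ι_of_notMem hz')
  have hg : ∀ x, g (S.ι (i x)) = S.ι (i x) * S.ι z := fun x => by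
    rw [S.mulAut_ι_of_mem _ _ (Set.mem_range_self x), one_mul]
  have hg' : ∀ x, g⁻¹ (S.ι (i x)) = S.ι (i x) * (S.ι z)⁻¹ := fun x => by
    rw [S.mulAut_inv_ι_of_mem _ _ (Set.mem_range_self x), inv_one, one_mul]
  have hgz : g (S.ι z) = S.ι z := S.mulAut_ι_of_notMem _ _ hz'
  set d := g⁻¹ (φ (S.ι z)) with hd
  have hψ : ∀ x, (g⁻¹ * φ * g) (S.ι (i x)) = S.ι (i x) * ((S.ι z)⁻¹ * d) := fun x => by
    rw [MulAut.mul_apply, MulAut.mul_apply, hg, map_mul, hfix, map_mul, hg', mul_assoc]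
  have hsmall : HasSmallClass X (g⁻¹ * φ * g) := by simpa using hφ.conj g⁻¹
  obtain ⟨k, hk, hki, hW, -⟩ := S.exists_letterLike hsmall hi
  obtain ⟨A, hA⟩ := S.exists_finset ((S.ι z)⁻¹ * d)
  obtain ⟨_, ⟨x, rfl⟩, hxA⟩ := (Set.infinite_range_of_injective hk).exists_notMem_finset A
  obtain ⟨_, ⟨y, rfl⟩, hyx⟩ := (Set.infinite_range_of_injective hk).exists_notMem_finset {k x}
  have hxy : k x ≠ k y := fun h => hyx (by simp [h])
  have h := hW.transvection_eq _ ⟨x, rfl⟩ _ ⟨y, rfl⟩ hxy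
  obtain ⟨x', hx'⟩ := hki ⟨x, rfl⟩
  obtain ⟨y', hy'⟩ := hki ⟨y, rfl⟩
  have hτ : S.transvection (k x) (k y) ((S.ι z)⁻¹ * d) = (S.ι z)⁻¹ * d :=
    hA _ (MonoidHom.id G) fun a ha => S.transvection_ι_of_ne _ fun h => hxA (h ▸ ha)
  simp only [← hx', ← hy', hψ] at h hτ
  rw [map_mul, hτ, transvection_ι_self] at h
  have hc : (S.ι z)⁻¹ * d = 1 := by
    generalize (S.ι z)⁻¹ * d = c at h
    simpa only [mul_assoc, mul_right_inj, right_eq_mul] using h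
  have hdz : d = S.ι z := (inv_mul_eq_one.mp hc).symm
  have hφz : φ (S.ι z) = g d := by rw [hd, MulAut.apply_inv_self]
  rw [hφz, hdz, hgz, MulAut.one_apply]

/-- The inner automorphisms are the automorphisms with small conjugacy class. -/
lemma exists_eq_conj (S : MagnusExtension X G N) [Infinite X] {φ : MulAut G} {s : X → G}
    (hs : Function.Surjective s)
    (hφ : HasSmallClass X φ) : ∃ u, φ = MulAut.conj u := by
  obtain ⟨i, hi, -, -, u, hu⟩ := S.exists_letterLike hφ Function.injective_id
  refine ⟨u, ?_⟩
  have h1 : HasSmallClass X ((MulAut.conj u)⁻¹ * φ) :=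
    (HasSmallClass.mulAut_conj hs u).inv.mul hφ
  have := S.eq_one_of_hasSmallClass h1 hi fun x => by
    rw [MulAut.mul_apply, hu, ← map_inv, MulAut.conj_apply]
    group
  exact (inv_mul_eq_one.mp this).symm

end MagnusExtension

namespace MagnusExtension

variable {X G N : Type*} [Group G] [Group N]

lemma conj_injective (S : MagnusExtension X G N) [Infinite X] :
    Function.Injective (MulAut.conj : G →* MulAut G) := by
  refine (injective_iff_map_eq_one _).mpr fun g hg => S.eq_one_of_forall_commute fun h => ?_
  have := DFunLike.congr_fun hg h
  rwa [MulAut.conj_apply, MulAut.one_apply, mul_inv_eq_iff_eq_mul] at this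

lemma _root_.MulAut.conj_apply_eq_mul {G : Type*} [Group G] (φ : MulAut G) (g : G) :
    MulAut.conj (φ g) = φ * MulAut.conj g * φ⁻¹ := by
  ext h
  simp [MulAut.conj_apply]

lemma center_mulAut_eq_bot (S : MagnusExtension X G N) [Infinite X] :
    Subgroup.center (MulAut G) = ⊥ := by
  refine (Subgroup.eq_bot_iff_forall _).mpr fun φ hφ => MulEquiv.ext fun g => ?_
  refine S.conj_injective ?_
  rw [MulAut.conj_apply_eq_mul, ← Subgroup.mem_center_iff.mp hφ, mul_inv_cancel_right,
    MulAut.one_apply]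

/-- Burnside's argument: the inner automorphisms form a characteristic subgroup of `MulAut G`. -/
lemma exists_forall_apply_eq_conj (S : MagnusExtension X G N) [Infinite X] {s : X → G}
    (hs : Function.Surjective s) (Φ : MulAut (MulAut G)) :
    ∃ ψ : MulAut G, ∀ φ : MulAut G, Φ φ = ψ * φ * ψ⁻¹ := by
  have h : ∀ (Ψ : MulAut (MulAut G)) g, ∃ u, MulAut.conj u = Ψ (MulAut.conj g) := fun Ψ g => by
    obtain ⟨u, hu⟩ := S.exists_eq_conj hs ((HasSmallClass.mulAut_conj hs g).map Ψ)
    exact ⟨u, hu.symm⟩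
  choose f hf using h Φ
  choose f' hf' using h Φ⁻¹
  let ψ : MulAut G :=
    { toFun := f
      invFun := f'
      left_inv := fun g => S.conj_injective (by rw [hf', hf, MulAut.inv_apply_self])
      right_inv := fun g => S.conj_injective (by rw [hf, hf', MulAut.apply_inv_self])
      map_mul' := fun g g' => S.conj_injective (by simp only [map_mul, hf]) }
  refine ⟨ψ, fun φ => eq_mul_inv_of_mul_eq (MulEquiv.ext fun g => S.conj_injective ?_)⟩
  change MulAut.conj (Φ φ (f g)) = MulAut.conj (f (φ g))
  rw [hf, MulAut.conj_apply_eq_mul, MulAut.conj_apply_eq_mul, hf, map_mul, map_mul, map_inv]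

end MagnusExtension

lemma ResiduallyTorsionFreeNilpotent.eq_one_of_pow_eq_one {H : Type*} [Group H]
    (hH : ResiduallyTorsionFreeNilpotent H) {h : H} {n : ℕ} (hn : n ≠ 0) (hpow : h ^ n = 1) :
    h = 1 := by
  by_contra h1
  obtain ⟨N, _, hhN, -, htf⟩ := hH h h1
  refine htf (h : H ⧸ N) (mt (QuotientGroup.eq_one_iff h).mp hhN) n hn ?_
  rw [← QuotientGroup.mk_pow, hpow, QuotientGroup.mk_one]

namespace MagnusExtension

open MonoidAlgebra (of)

section FreeGroup

variable {X : Type*} (R : Subgroup (FreeGroup X)) [R.Normal]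

/-- The affine action of the free group on a free module over the group ring of `F ⧸ R`, the
generator `x` acting by `m ↦ e_x + x • m`. -/
noncomputable def affine :
    FreeGroup X →* Equiv.Perm (X →₀ MonoidAlgebra ℤ (FreeGroup X ⧸ R)) :=
  FreeGroup.lift fun x =>
    { toFun := fun m => Finsupp.single x 1 + of ℤ (FreeGroup X ⧸ R) (FreeGroup.of x) • m
      invFun := fun m =>
        of ℤ (FreeGroup X ⧸ R) (FreeGroup.of x : FreeGroup X ⧸ R)⁻¹ • (m - Finsupp.single x 1)
      left_inv := fun m => by
        beta_reduce
        rw [add_sub_cancel_left, smul_smul, ← map_mul, inv_mul_cancel, map_one, one_smul]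
      right_inv := fun m => by
        beta_reduce
        rw [smul_smul, ← map_mul, mul_inv_cancel, map_one, one_smul, add_sub_cancel] }

lemma affine_of (x : X) (m : X →₀ MonoidAlgebra ℤ (FreeGroup X ⧸ R)) :
    affine R (FreeGroup.of x) m =
      Finsupp.single x 1 + of ℤ (FreeGroup X ⧸ R) (FreeGroup.of x) • m := by
  rw [affine, FreeGroup.lift_apply_of]
  rfl

lemma affine_apply (g : FreeGroup X) (m : X →₀ MonoidAlgebra ℤ (FreeGroup X ⧸ R)) :
    affine R g m = affine R g 0 + of ℤ (FreeGroup X ⧸ R) g • m := by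
  induction g using FreeGroup.induction_on generalizing m with
  | C1 => rw [map_one, Equiv.Perm.one_apply, Equiv.Perm.one_apply, QuotientGroup.mk_one, map_one,
      one_smul, zero_add]
  | of x => rw [affine_of, affine_of, smul_zero, add_zero]
  | inv_of x _ =>
    have h (m) : (affine R (FreeGroup.of x)⁻¹) m = of ℤ (FreeGroup X ⧸ R)
        (FreeGroup.of x : FreeGroup X ⧸ R)⁻¹ • (m - Finsupp.single x 1) := by
      rw [map_inv, Equiv.Perm.inv_eq_iff_eq, affine_of, smul_smul, ← map_mul, mul_inv_cancel,
        map_one, one_smul, add_sub_cancel]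
    rw [h, h, QuotientGroup.mk_inv, ← smul_add]
    congr 1
    abel
  | mul g h hg hh =>
    rw [map_mul, Equiv.Perm.mul_apply, Equiv.Perm.mul_apply, hg, hh, hg (affine R h 0), smul_add,
      smul_smul, ← map_mul, add_assoc, QuotientGroup.mk_mul]

lemma commutator_le_ker_affine : ⁅R, R⁆ ≤ (affine R).ker := by
  refine Subgroup.commutator_le.mpr fun g hg h hh => ?_
  rw [MonoidHom.mem_ker, map_commutatorElement, commutatorElement_eq_one_iff_mul_comm]
  refine Equiv.ext fun m => ?_
  have key : ∀ r ∈ R, ∀ m, affine R r m = affine R r 0 + m := fun r hr m => by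
    rw [affine_apply, (QuotientGroup.eq_one_iff r).mpr hr, map_one, one_smul]
  rw [Equiv.Perm.mul_apply, Equiv.Perm.mul_apply, key g hg, key h hh, key h hh (affine R g m),
    key g hg m, add_left_comm]

lemma of_notMem_of_le_commutator {R : Subgroup (FreeGroup X)} (hR : R ≤ commutator (FreeGroup X))
    (x : X) : FreeGroup.of x ∉ R := fun hx => by
  have h := Abelianization.commutator_subset_ker
    (FreeGroup.lift fun _ : X => Multiplicative.ofAdd (1 : ℤ)) (hR hx)
  simp [MonoidHom.mem_ker] at h

/-- The endomorphism of `F ⧸ S` with prescribed values on the generators, where `S` is a fully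
invariant subgroup. -/
noncomputable def quotientLift {S : Subgroup (FreeGroup X)} [S.Normal]
    (hS : ∀ f : FreeGroup X →* FreeGroup X, S.map f ≤ S) (f : X → FreeGroup X) :
    FreeGroup X ⧸ S →* FreeGroup X ⧸ S :=
  QuotientGroup.map S S (FreeGroup.lift f) (Subgroup.map_le_iff_le_comap.mp (hS _))

lemma quotientLift_mk {S : Subgroup (FreeGroup X)} [S.Normal]
    (hS : ∀ f : FreeGroup X →* FreeGroup X, S.map f ≤ S) (f : X → FreeGroup X) (g : FreeGroup X) :
    quotientLift hS f g = FreeGroup.lift f g := rfl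

lemma map_commutator_le {R : Subgroup (FreeGroup X)}
    (hR : ∀ f : FreeGroup X →* FreeGroup X, R.map f ≤ R) (f : FreeGroup X →* FreeGroup X) :
    ⁅R, R⁆.map f ≤ ⁅R, R⁆ := by
  rw [Subgroup.map_commutator]
  exact Subgroup.commutator_mono (hR f) (hR f)

/-- The projection `F ⧸ ⁅R, R⁆ →* F ⧸ R`. -/
def quotientProj : FreeGroup X ⧸ ⁅R, R⁆ →* FreeGroup X ⧸ R :=
  QuotientGroup.lift ⁅R, R⁆ (QuotientGroup.mk' R) <| by
    rw [QuotientGroup.ker_mk']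
    exact Subgroup.commutator_le_left R R

lemma quotientProj_mk (g : FreeGroup X) : quotientProj R g = (g : FreeGroup X ⧸ R) := rfl

lemma quotientProj_apply_hom (f : FreeGroup X ⧸ ⁅R, R⁆ →* FreeGroup X ⧸ ⁅R, R⁆)
    (hR : ∀ f : FreeGroup X →* FreeGroup X, R.map f ≤ R) (g : FreeGroup X ⧸ ⁅R, R⁆) :
    quotientLift hR (fun x => (f (FreeGroup.of x : FreeGroup X)).out) (quotientProj R g) =
      quotientProj R (f g) := by
  have : ((quotientLift hR fun x => (f (FreeGroup.of x : FreeGroup X)).out).comp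
      (quotientProj R)).comp (QuotientGroup.mk' ⁅R, R⁆) =
      ((quotientProj R).comp f).comp (QuotientGroup.mk' ⁅R, R⁆) := by
    refine FreeGroup.ext_hom _ _ fun x => ?_
    simp only [MonoidHom.comp_apply, QuotientGroup.mk'_apply, quotientProj_mk, quotientLift_mk,
      FreeGroup.lift_apply_of]
    rw [← quotientProj_mk, QuotientGroup.out_eq']
  induction g using QuotientGroup.induction_on with
  | H g => exact DFunLike.congr_fun this g

/-- The Magnus extension `F ⧸ ⁅R, R⁆` of `F ⧸ R`. -/
noncomputable def ofFreeGroup (hR : ∀ f : FreeGroup X →* FreeGroup X, R.map f ≤ R)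
    (hRF' : R ≤ commutator (FreeGroup X))
    (hRTFN : ResiduallyTorsionFreeNilpotent (FreeGroup X ⧸ R)) :
    MagnusExtension X (FreeGroup X ⧸ ⁅R, R⁆) (FreeGroup X ⧸ R) where
  ι x := (FreeGroup.of x : FreeGroup X)
  lift f := quotientLift (map_commutator_le hR) fun x => (f x).out
  lift_ι f x := by
    rw [quotientLift_mk, FreeGroup.lift_apply_of, QuotientGroup.out_eq']
  closure_range := by
    have : Set.range (fun x : X => ((FreeGroup.of x : FreeGroup X) : FreeGroup X ⧸ ⁅R, R⁆)) =
        QuotientGroup.mk' ⁅R, R⁆ '' Set.range FreeGroup.of := by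
      rw [← Set.range_comp]
      rfl
    rw [this, ← MonoidHom.map_closure, FreeGroup.closure_range_of,
      Subgroup.map_top_of_surjective _ (QuotientGroup.mk'_surjective _)]
  q := quotientProj R
  q_surjective := QuotientGroup.lift_surjective_of_surjective _ _
    (QuotientGroup.mk'_surjective R) _
  bar f := quotientLift hR fun x => (f (FreeGroup.of x : FreeGroup X)).out
  bar_q f := quotientProj_apply_hom R f hR
  D g := QuotientGroup.lift _ (affine R) (commutator_le_ker_affine R) g 0
  D_ι x := by
    rw [QuotientGroup.lift_mk, affine_of, smul_zero, add_zero]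
  D_mul g h := by
    induction g using QuotientGroup.induction_on
    induction h using QuotientGroup.induction_on
    rw [MonoidHom.map_mul, Equiv.Perm.mul_apply, QuotientGroup.lift_mk, affine_apply]
    rfl
  ker_comm g h := by
    induction g using QuotientGroup.induction_on with | H g =>
    induction h using QuotientGroup.induction_on with | H h =>
    intro hg hh
    rw [quotientProj_mk, QuotientGroup.eq_one_iff] at hg hh
    rw [← commutatorElement_eq_one_iff_mul_comm, ← QuotientGroup.mk'_apply,
      ← QuotientGroup.mk'_apply, ← map_commutatorElement, QuotientGroup.mk'_apply,
      QuotientGroup.eq_one_iff]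
    exact Subgroup.commutator_mem_commutator hg hh
  q_ι_ne_one x := mt (QuotientGroup.eq_one_iff _).mp (of_notMem_of_le_commutator hRF' x)
  torsion_free n k hk hn := hRTFN.eq_one_of_pow_eq_one hk hn

end FreeGroup

end MagnusExtension

end

/-- Let `F = FreeGroup X` be a free group of infinite rank and `R` a fully invariant
subgroup of `F` contained in the commutator subgroup `F' = ⁅F, F⁆` such that `F/R` is
residually torsion-free nilpotent.  Then the automorphism group of `F ⧸ ⁅R, R⁆` is
complete: its center is trivial and all of its automorphisms are inner. -/
theorem aut_complete_of_residually_torsion_free_nilpotent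
    {X : Type*} [Infinite X] (R : Subgroup (FreeGroup X)) [R.Normal]
    (hR : ∀ f : FreeGroup X →* FreeGroup X, R.map f ≤ R)
    (hRF' : R ≤ commutator (FreeGroup X))
    (hRTFN : ResiduallyTorsionFreeNilpotent (FreeGroup X ⧸ R)) :
    Subgroup.center (MulAut (FreeGroup X ⧸ ⁅R, R⁆)) = ⊥ ∧
    ∀ Φ : MulAut (MulAut (FreeGroup X ⧸ ⁅R, R⁆)),
      ∃ ψ : MulAut (FreeGroup X ⧸ ⁅R, R⁆),
        ∀ φ : MulAut (FreeGroup X ⧸ ⁅R, R⁆), Φ φ = ψ * φ * ψ⁻¹ := by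
  have S := MagnusExtension.ofFreeGroup R hR hRF' hRTFN
  obtain ⟨e⟩ := Cardinal.eq.mp ((Cardinal.mk_freeGroup X).trans
    (max_eq_left (Cardinal.aleph0_le_mk X))).symm
  exact ⟨S.center_mulAut_eq_bot, S.exists_forall_apply_eq_conj
    ((QuotientGroup.mk'_surjective ⁅R, R⁆).comp e.surjective)⟩
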